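/- arXiv:2510.12846 — 3 statements merged into one kernel-verified Lean document; each statement's English description precedes it below -/
import Mathlib

section
/- Let p : ℕ → [0,1] satisfy 2⁹ n^{−2/3} ≤ p(n) ≤ e^{−52} 2^{−8} n^{−1/2} for all large n. Then 2.598^n · P_{n,p(n)}(D(A,B) contains no stable 4-cycle and the game (A,B) has no pure Nash equilibrium) → 0 as n → ∞. -/
open MeasureTheory Filter Finset
open scoped ENNReal

noncomputable def entryWeight (p : ℝ) (b : Bool) : ℝ≥0∞ :=
  if b then ENNReal.ofReal p else ENNReal.ofReal (1 - p)

noncomputable def pairWeight (n : ℕ) (p : ℝ)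
    (ω : (Fin n → Fin n → Bool) × (Fin n → Fin n → Bool)) : ℝ≥0∞ :=
  (∏ i : Fin n, ∏ j : Fin n, entryWeight p (ω.1 i j)) *
    (∏ i : Fin n, ∏ j : Fin n, entryWeight p (ω.2 i j))

/-- The i.i.d. Bernoulli(p) measure `P_{n,p}` on pairs of n×n Boolean matrices. -/
noncomputable def gameMeasure (n : ℕ) (p : ℝ) :
    Measure ((Fin n → Fin n → Bool) × (Fin n → Fin n → Bool)) :=
  Measure.sum fun ω => pairWeight n p ω • Measure.dirac ω

/-- A directed 2ℓ-cycle in the bipartite digraph D(A,B): ℓ distinct rows and ℓ distinct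
columns with B(i_k, j_k) = 1 and A(i_{k+1}, j_k) = 1 for all k (indices mod ℓ). -/
def IsCycle (ℓ n : ℕ) (A B : Fin n → Fin n → Bool) (r c : ZMod ℓ → Fin n) : Prop :=
  Function.Injective r ∧ Function.Injective c ∧
    (∀ k, B (r k) (c k) = true) ∧ ∀ k, A (r (k + 1)) (c k) = true

/-- A stable 2ℓ-cycle: additionally, every row outside the cycle has at most one
out-neighbour (w.r.t. A) among the cycle's columns, and every column outside the cycle
has at most one in-neighbour (w.r.t. B) among the cycle's rows. -/
def IsStableCycle (ℓ n : ℕ) (A B : Fin n → Fin n → Bool) (r c : ZMod ℓ → Fin n) : Prop :=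
  IsCycle ℓ n A B r c ∧
    (∀ i : Fin n, i ∉ Set.range r →
      ∀ k k' : ZMod ℓ, A i (c k) = true → A i (c k') = true → c k = c k') ∧
    (∀ j : Fin n, j ∉ Set.range c →
      ∀ k k' : ZMod ℓ, B (r k) j = true → B (r k') j = true → r k = r k')

theorem card_finset_le_exp {ι : Type*} [Fintype ι] (s : Finset (Finset ι)) :
    (#s : ℝ) ≤ Real.exp (Fintype.card ι) := by
  have h : #s ≤ 2 ^ Fintype.card ι := by
    simpa using card_le_univ s
  calc (#s : ℝ) ≤ 2 ^ Fintype.card ι := by exact_mod_cast h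
    _ ≤ Real.exp 1 ^ Fintype.card ι := by
      gcongr
      linarith [Real.add_one_le_exp (1 : ℝ)]
    _ = _ := by rw [← Real.exp_nat_mul, mul_one]

section FiniteProbability

open scoped Classical

/-- The expectation of `f` under the weight `w` on a finite type. -/
noncomputable def wexp {α : Type*} [Fintype α] (w f : α → ℝ) : ℝ := ∑ x, w x * f x

/-- The probability of the event `P` under the weight `w` on a finite type. -/
noncomputable def wprob {α : Type*} [Fintype α] (w : α → ℝ) (P : α → Prop) : ℝ :=
  wexp w fun x => if P x then 1 else 0

/-- `w` is a probability weight: nonnegative with total mass one. -/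
structure IsWeight {α : Type*} [Fintype α] (w : α → ℝ) : Prop where
  nonneg : ∀ x, 0 ≤ w x
  sum_one : ∑ x, w x = 1

/-- The product weight on functions. -/
noncomputable def piWeight {ι X : Type*} [Fintype ι] (w : X → ℝ) (x : ι → X) : ℝ :=
  ∏ i, w (x i)

/-- The product weight on pairs. -/
def prodWeight {α β : Type*} (w : α → ℝ) (v : β → ℝ) (z : α × β) : ℝ := w z.1 * v z.2

variable {α β ι κ X : Type*} [Fintype α] [Fintype β] [Fintype ι] [Fintype X] [DecidableEq ι]

theorem wexp_mono {w f g : α → ℝ} (hw : IsWeight w) (h : ∀ x, f x ≤ g x) :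
    wexp w f ≤ wexp w g :=
  sum_le_sum fun x _ => mul_le_mul_of_nonneg_left (h x) (hw.nonneg x)

theorem wexp_sum (w : α → ℝ) (s : Finset κ) (f : κ → α → ℝ) :
    wexp w (fun x => ∑ i ∈ s, f i x) = ∑ i ∈ s, wexp w (f i) := by
  simp only [wexp, mul_sum]
  exact sum_comm

theorem wexp_div (w f : α → ℝ) (t : ℝ) : wexp w (fun x => f x / t) = wexp w f / t := by
  simp only [wexp, sum_div, mul_div_assoc]

theorem wexp_const {w : α → ℝ} (hw : IsWeight w) (c : ℝ) : wexp w (fun _ => c) = c := by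
  simp only [wexp, ← sum_mul, hw.sum_one, one_mul]

theorem wprob_mono {w : α → ℝ} (hw : IsWeight w) {P Q : α → Prop} (h : ∀ x, P x → Q x) :
    wprob w P ≤ wprob w Q := by
  refine wexp_mono hw fun x => ?_
  by_cases hP : P x
  · simp [hP, h x hP]
  · simp only [hP, if_false]; split_ifs <;> norm_num

theorem wprob_nonneg {w : α → ℝ} (hw : IsWeight w) (P : α → Prop) : 0 ≤ wprob w P :=
  sum_nonneg fun x _ => mul_nonneg (hw.nonneg x) (by dsimp only; split_ifs <;> norm_num)

theorem wprob_false (w : α → ℝ) : wprob w (fun _ => False) = 0 := by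
  simp [wprob, wexp]

theorem wprob_exists_le {w : α → ℝ} (hw : IsWeight w) (s : Finset κ) (P : κ → α → Prop) :
    wprob w (fun x => ∃ i ∈ s, P i x) ≤ ∑ i ∈ s, wprob w (P i) := by
  simp only [wprob]
  rw [← wexp_sum]
  refine wexp_mono hw fun x => ?_
  have hn : ∀ i ∈ s, (0 : ℝ) ≤ if P i x then 1 else 0 := fun i _ => by split_ifs <;> norm_num
  split_ifs with h
  · obtain ⟨i, hi, hP⟩ := h
    exact le_trans (by simp [hP]) (single_le_sum hn hi)
  · exact sum_nonneg hn

theorem wprob_exists_le_card {w : α → ℝ} (hw : IsWeight w) (s : Finset κ) (P : κ → α → Prop)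
    {q : ℝ} (h : ∀ i ∈ s, wprob w (P i) ≤ q) :
    wprob w (fun x => ∃ i ∈ s, P i x) ≤ #s * q := by
  refine (wprob_exists_le hw s P).trans ((sum_le_sum h).trans ?_)
  simp

theorem wprob_or_le {w : α → ℝ} (hw : IsWeight w) (P Q : α → Prop) :
    wprob w (fun x => P x ∨ Q x) ≤ wprob w P + wprob w Q := by
  simp only [wprob, wexp]
  rw [← sum_add_distrib]
  refine sum_le_sum fun x _ => ?_
  rw [← mul_add]
  refine mul_le_mul_of_nonneg_left ?_ (hw.nonneg x)
  by_cases hP : P x <;> by_cases hQ : Q x <;> simp [hP, hQ]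

theorem wprob_le_wexp_div {w f : α → ℝ} (hw : IsWeight w) (hf : ∀ x, 0 ≤ f x) {t : ℝ}
    (ht : 0 < t) : wprob w (fun x => t ≤ f x) ≤ wexp w f / t := by
  rw [← wexp_div]
  refine wexp_mono hw fun x => ?_
  split_ifs with h
  · rwa [one_le_div ht]
  · exact div_nonneg (hf x) ht.le

theorem IsWeight.prodWeight {w : α → ℝ} {v : β → ℝ} (hw : IsWeight w) (hv : IsWeight v) :
    IsWeight (prodWeight w v) where
  nonneg z := mul_nonneg (hw.nonneg _) (hv.nonneg _)
  sum_one := by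
    simp only [_root_.prodWeight, Fintype.sum_prod_type, ← mul_sum, hv.sum_one, mul_one, hw.sum_one]

theorem wprob_prod_le_right {w : α → ℝ} {v : β → ℝ} (hw : IsWeight w)
    {P : α → β → Prop} {q : ℝ} (h : ∀ x, wprob v (P x) ≤ q) :
    wprob (prodWeight w v) (fun z => P z.1 z.2) ≤ q := by
  rw [← wexp_const hw q]
  refine le_trans (le_of_eq ?_) (wexp_mono hw h)
  simp only [wprob, wexp, prodWeight, Fintype.sum_prod_type, mul_sum, mul_assoc]

theorem wprob_prod_le_left {w : α → ℝ} {v : β → ℝ} (hv : IsWeight v)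
    {P : α → β → Prop} {q : ℝ} (h : ∀ y, wprob w (fun x => P x y) ≤ q) :
    wprob (prodWeight w v) (fun z => P z.1 z.2) ≤ q := by
  rw [← wexp_const hv q]
  refine le_trans (le_of_eq ?_) (wexp_mono hv h)
  simp only [wprob, wexp, prodWeight, Fintype.sum_prod_type_right, mul_sum]
  refine sum_congr rfl fun y _ => sum_congr rfl fun x _ => by ring

theorem wexp_piWeight_prod (w : X → ℝ) (h : ι → X → ℝ) :
    wexp (piWeight w) (fun x => ∏ i, h i (x i)) = ∏ i, wexp w (h i) := by
  simp only [wexp, piWeight, ← prod_mul_distrib]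
  rw [prod_univ_sum, Fintype.piFinset_univ]

theorem IsWeight.piWeight {w : X → ℝ} (hw : IsWeight w) :
    IsWeight (piWeight w : (ι → X) → ℝ) where
  nonneg x := prod_nonneg fun i _ => hw.nonneg _
  sum_one := by
    have := wexp_piWeight_prod (ι := ι) w fun _ _ => 1
    simpa [wexp, hw.sum_one] using this

theorem wprob_piWeight_forall {w : X → ℝ} (hw : IsWeight w) (T : Finset ι) (E : ι → X → Prop) :
    wprob (piWeight w) (fun x => ∀ i ∈ T, E i (x i)) = ∏ i ∈ T, wprob w (E i) := by
  have h := wexp_piWeight_prod w fun i y => if i ∈ T then (if E i y then (1 : ℝ) else 0) else 1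
  have h1 : ∀ i, wexp w (fun y => if i ∈ T then (if E i y then (1 : ℝ) else 0) else 1) =
      if i ∈ T then wprob w (E i) else 1 := by
    intro i
    split_ifs
    · rfl
    · exact wexp_const hw 1
  simp only [h1, prod_ite_mem, univ_inter] at h
  rw [← h, wprob]
  congr 1
  ext x
  rw [prod_ite_zero]
  simp

theorem wprob_piWeight_forall_le {w : X → ℝ} (hw : IsWeight w) (T : Finset ι) (E : ι → X → Prop)
    {c t : ℝ} (hc : 0 ≤ c) (ht : t ≤ #T) (h : ∀ i ∈ T, wprob w (E i) ≤ Real.exp (-c)) :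
    wprob (piWeight w) (fun x => ∀ i ∈ T, E i (x i)) ≤ Real.exp (-(c * t)) := by
  rw [wprob_piWeight_forall hw]
  refine (prod_le_prod (fun i _ => wprob_nonneg hw _) h).trans ?_
  rw [prod_const, ← Real.exp_nat_mul]
  refine Real.exp_le_exp.2 ?_
  nlinarith

theorem wprob_piWeight_count_le {w : X → ℝ} (hw : IsWeight w) (U : Finset ι) (E : ι → X → Prop)
    [∀ i y, Decidable (E i y)]
    {c : ℝ} (hc : 0 ≤ c) (t : ℝ) (h : ∀ i ∈ U, wprob w (E i) ≤ Real.exp (-c)) :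
    wprob (piWeight w) (fun x => t ≤ #{i ∈ U | E i (x i)}) ≤
      Real.exp (Fintype.card ι - c * t) := by
  have h1 : wprob (piWeight w) (fun x => t ≤ #{i ∈ U | E i (x i)}) ≤
      wprob (piWeight w) (fun x => ∃ T ∈ ({T ∈ U.powerset | t ≤ #T} : Finset (Finset ι)),
        ∀ i ∈ T, E i (x i)) := by
    refine wprob_mono hw.piWeight fun x hx =>
      ⟨{i ∈ U | E i (x i)}, ?_, fun i hi => (mem_filter.1 hi).2⟩
    simpa using hx
  refine h1.trans ((wprob_exists_le_card hw.piWeight _ _ (q := Real.exp (-(c * t))) ?_).trans ?_)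
  · intro T hT
    rw [mem_filter, mem_powerset] at hT
    exact wprob_piWeight_forall_le hw T E hc hT.2 fun i hi => h i (hT.1 hi)
  · rw [sub_eq_add_neg, Real.exp_add]
    refine mul_le_mul_of_nonneg_right ?_ (Real.exp_pos _).le
    exact card_finset_le_exp _

theorem wprob_piWeight_le_of_resample {w : X → ℝ} (hw : IsWeight w) (S : Finset ι)
    (P : (ι → X) → Prop) {q : ℝ}
    (h : ∀ y, wprob (piWeight w) (fun x => P (S.piecewise y x)) ≤ q) :
    wprob (piWeight w) P ≤ q := by
  have h1 := wprob_prod_le_right (P := fun y x => P (S.piecewise y x))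
    (hw.piWeight (ι := ι)) h
  refine le_trans (le_of_eq ?_) h1
  have h2 : wprob (prodWeight (piWeight w) (piWeight w)) (fun z : (ι → X) × (ι → X) => P z.1) =
      wprob (piWeight w) P := by
    simp only [wprob, wexp, prodWeight, Fintype.sum_prod_type]
    refine sum_congr rfl fun x _ => ?_
    trans ∑ y : ι → X, piWeight w y * (piWeight w x * if P x then 1 else 0)
    · exact sum_congr rfl fun y _ => by ring
    · rw [← sum_mul, hw.piWeight.sum_one, one_mul]
  rw [← h2]
  have hinv : Function.Involutive fun z : (ι → X) × (ι → X) =>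
      (S.piecewise z.1 z.2, S.piecewise z.2 z.1) := by
    intro z
    ext i <;> by_cases hi : i ∈ S <;> simp [hi]
  refine Fintype.sum_equiv hinv.toPerm _ _ fun z => ?_
  have h3 : S.piecewise (S.piecewise z.1 z.2) (S.piecewise z.2 z.1) = z.1 :=
    congrArg Prod.fst (hinv z)
  simp only [Function.Involutive.coe_toPerm, h3]
  congr 1
  simp only [prodWeight, piWeight, ← prod_mul_distrib]
  refine prod_congr rfl fun i _ => ?_
  by_cases hi : i ∈ S <;> simp [hi, mul_comm]

theorem wprob_piWeight_flip {V : Type*} [Fintype V] [DecidableEq V] (w : X → ℝ)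
    (P : (ι → V → X) → Prop) :
    wprob (piWeight (piWeight w)) P =
      wprob (piWeight (piWeight w)) (fun x : V → ι → X => P fun i v => x v i) := by
  refine Fintype.sum_equiv (Equiv.piComm fun _ _ => X) _ _ fun x => ?_
  congr 1
  simp only [piWeight, Equiv.piComm_apply, Function.swap]
  exact prod_comm

/-- The Bernoulli weight on `Bool`. -/
noncomputable def bern (p : ℝ) (b : Bool) : ℝ := if b then p else 1 - p

theorem isWeight_bern {p : ℝ} (h0 : 0 ≤ p) (h1 : p ≤ 1) : IsWeight (bern p) where
  nonneg b := by cases b <;> simp [bern, h0, h1]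
  sum_one := by simp [bern]

variable {V : Type*} [Fintype V] [DecidableEq V] {p : ℝ}

theorem wexp_exp_mul_card (p t : ℝ) (G : Finset V) :
    wexp (piWeight (bern p)) (fun x => Real.exp (t * #{v ∈ G | x v = true})) =
      (1 + p * (Real.exp t - 1)) ^ #G := by
  have h := wexp_piWeight_prod (bern p)
    fun v b => if v ∈ G then (if b = true then Real.exp t else 1) else 1
  have h1 : ∀ v : V, wexp (bern p)
      (fun b => if v ∈ G then (if b = true then Real.exp t else 1) else 1) =
        if v ∈ G then 1 + p * (Real.exp t - 1) else 1 := by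
    intro v
    split_ifs
    · simp [wexp, bern]; ring
    · simp [wexp, bern]
  simp only [h1, prod_ite_mem, univ_inter, prod_const] at h
  rw [← h]
  congr 1
  ext x
  rw [prod_ite, prod_const, prod_const_one, mul_one, ← Real.exp_nat_mul, mul_comm]

theorem wprob_card_le (h0 : 0 ≤ p) (h1 : p ≤ 1) (G : Finset V) (t : ℝ) :
    wprob (piWeight (bern p)) (fun x => (#{v ∈ G | x v = true} : ℝ) ≤ t) ≤
      Real.exp (t - p * #G / 2) := by
  have hw : IsWeight (piWeight (bern p) : (V → Bool) → ℝ) := (isWeight_bern h0 h1).piWeight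
  have h2 := wprob_le_wexp_div hw
    (f := fun x : V → Bool => Real.exp (-1 * #{v ∈ G | x v = true}))
    (fun x => (Real.exp_pos _).le) (Real.exp_pos (-t))
  rw [wexp_exp_mul_card] at h2
  refine (wprob_mono hw fun x hx => ?_).trans (h2.trans ?_)
  · refine Real.exp_le_exp.2 ?_
    linarith
  · rw [div_le_iff₀ (Real.exp_pos _), ← Real.exp_add]
    have h3 : Real.exp (-1) ≤ 1 / 2 := by
      rw [Real.exp_neg, inv_eq_one_div]
      refine one_div_le_one_div_of_le two_pos ?_
      linarith [Real.add_one_le_exp (1 : ℝ)]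
    have h4 : 1 + p * (Real.exp (-1) - 1) ≤ Real.exp (-(p / 2)) := by
      have := Real.add_one_le_exp (-(p / 2))
      nlinarith
    have h5 : 0 ≤ 1 + p * (Real.exp (-1) - 1) := by
      nlinarith [Real.exp_pos (-1)]
    refine (pow_le_pow_left₀ h5 h4 _).trans (le_of_eq ?_)
    rw [← Real.exp_nat_mul]
    congr 1
    ring

theorem wprob_lt_card (h0 : 0 ≤ p) (h1 : p ≤ 1) (G : Finset V) (t : ℝ) :
    wprob (piWeight (bern p)) (fun x => t < (#{v ∈ G | x v = true} : ℝ)) ≤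
      Real.exp (2 * p * #G - t) := by
  have hw : IsWeight (piWeight (bern p) : (V → Bool) → ℝ) := (isWeight_bern h0 h1).piWeight
  have h2 := wprob_le_wexp_div hw
    (f := fun x : V → Bool => Real.exp (1 * #{v ∈ G | x v = true}))
    (fun x => (Real.exp_pos _).le) (Real.exp_pos t)
  rw [wexp_exp_mul_card] at h2
  refine (wprob_mono hw fun x hx => ?_).trans (h2.trans ?_)
  · refine Real.exp_le_exp.2 ?_
    linarith
  · rw [div_le_iff₀ (Real.exp_pos _), ← Real.exp_add]
    have h3 := Real.exp_one_lt_d9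
    have h4 : 1 + p * (Real.exp 1 - 1) ≤ Real.exp (2 * p) := by
      have := Real.add_one_le_exp (2 * p)
      nlinarith
    have h5 : 0 ≤ 1 + p * (Real.exp 1 - 1) := by
      nlinarith [Real.add_one_le_exp (1 : ℝ)]
    refine (pow_le_pow_left₀ h5 h4 _).trans (le_of_eq ?_)
    rw [← Real.exp_nat_mul]
    congr 1
    ring

theorem wprob_true_true (h0 : 0 ≤ p) (h1 : p ≤ 1) {u v : V} (huv : u ≠ v) :
    wprob (piWeight (bern p)) (fun x : V → Bool => x u = true ∧ x v = true) = p ^ 2 := by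
  have h := wprob_piWeight_forall (isWeight_bern h0 h1) {u, v} fun _ b => b = true
  simp only [mem_insert, mem_singleton, forall_eq_or_imp, forall_eq, prod_pair huv] at h
  rw [h]
  simp [wprob, wexp, bern, sq]

/-- With few exceptions, a Bernoulli set contains a point `u k` with `k ∈ G` but none of the
elements of the small set `N k` associated to `k`. -/
theorem wprob_no_isolated_hit_le {κ : Type*} (h0 : 0 ≤ p) (h1 : p ≤ 1) (G : Finset κ)
    {u : κ → V} (hu : Set.InjOn u G) (N : κ → Finset V) {D : ℝ}
    (hN : ∀ k ∈ G, (#(N k) : ℝ) ≤ D) (hG : ∀ k ∈ G, u k ∉ N k) :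
    wprob (piWeight (bern p))
      (fun x : V → Bool => ¬ ∃ k ∈ G, x (u k) = true ∧ ∀ v ∈ N k, x v = false) ≤
      Real.exp (-(p * #G / 2)) + #G * (D * p ^ 2) := by
  have hw : IsWeight (piWeight (bern p) : (V → Bool) → ℝ) := (isWeight_bern h0 h1).piWeight
  have h2 := wprob_card_le h0 h1 (G.image u) 0
  rw [zero_sub, card_image_of_injOn hu] at h2
  refine le_trans ?_ (add_le_add h2 (wprob_exists_le_card hw G
    (fun k x => ∃ v ∈ N k, x (u k) = true ∧ x v = true) fun k hk => ?_))
  · refine (wprob_mono hw fun x hx => ?_).trans (wprob_or_le hw _ _)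
    by_cases hhit : ∃ k ∈ G, x (u k) = true
    · right
      obtain ⟨k, hk, hkx⟩ := hhit
      refine ⟨k, hk, ?_⟩
      by_contra! hcon
      exact hx ⟨k, hk, hkx, fun v hv => by simpa using hcon v hv hkx⟩
    · left
      push Not at hhit
      rw [filter_false_of_mem (by simpa using hhit)]
      simp
  · refine (wprob_exists_le_card hw (N k) _ (q := p ^ 2) fun v hv => ?_).trans ?_
    · exact (wprob_true_true h0 h1 (by rintro rfl; exact hG _ hk hv)).le
    · exact mul_le_mul_of_nonneg_right (hN k hk) (sq_nonneg p)

/-- The set `{v | x v = true}` has at most `D` elements. -/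
def IsLight (D : ℝ) (x : V → Bool) : Prop := (#{v | x v = true} : ℝ) ≤ D

theorem wprob_heavy_count_le (h0 : 0 ≤ p) (h1 : p ≤ 1) (S : Finset V) (t : ℝ) :
    wprob (piWeight (piWeight (bern p)))
      (fun A : V → V → Bool => t ≤ #{j ∈ S | ¬ IsLight (4 * Fintype.card V * p) (A j)}) ≤
      Real.exp (Fintype.card V - 2 * Fintype.card V * p * t) := by
  refine wprob_piWeight_count_le (isWeight_bern h0 h1).piWeight S
    (fun _ x => ¬ IsLight (4 * Fintype.card V * p) x) (by positivity) t fun j _ => ?_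
  have h := wprob_lt_card h0 h1 (univ : Finset V) (4 * Fintype.card V * p)
  rw [card_univ] at h
  simp only [IsLight, not_le]
  refine h.trans (le_of_eq ?_)
  congr 1
  ring

/-- Few columns meet a given large set of rows in fewer entries than expected. -/
theorem wprob_sparse_columns_le (h0 : 0 ≤ p) (h1 : p ≤ 1) (S : Finset V) (t : ℝ) :
    wprob (piWeight (piWeight (bern p)))
      (fun B : V → V → Bool => ∃ R : Finset V, (Fintype.card V : ℝ) / 4 ≤ #R ∧
        t ≤ #{j ∈ S | (#{i ∈ R | B i j = true} : ℝ) ≤ p * Fintype.card V / 16}) ≤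
      Real.exp (2 * Fintype.card V - p * Fintype.card V / 16 * t) := by
  have hb := isWeight_bern h0 h1
  rw [wprob_piWeight_flip]
  have hexists := wprob_exists_le_card hb.piWeight.piWeight
    ({R : Finset V | (Fintype.card V : ℝ) / 4 ≤ #R} : Finset (Finset V))
    (fun R (B : V → V → Bool) =>
      t ≤ #{j ∈ S | (#{i ∈ R | B j i = true} : ℝ) ≤ p * Fintype.card V / 16})
    (q := Real.exp (Fintype.card V - p * Fintype.card V / 16 * t)) fun R hR => ?_
  · refine (wprob_mono hb.piWeight.piWeight fun B hB => ?_).trans (hexists.trans ?_)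
    · obtain ⟨R, hR, hRt⟩ := hB
      exact ⟨R, by simpa using hR, hRt⟩
    · refine (mul_le_mul_of_nonneg_right (card_finset_le_exp _) (Real.exp_pos _).le).trans ?_
      rw [← Real.exp_add]
      exact Real.exp_le_exp.2 (by linarith)
  · rw [mem_filter_univ] at hR
    refine wprob_piWeight_count_le hb.piWeight S
      (fun _ x => (#{i ∈ R | x i = true} : ℝ) ≤ p * Fintype.card V / 16)
      (by positivity) t fun j _ => ?_
    refine (wprob_card_le h0 h1 R _).trans (Real.exp_le_exp.2 ?_)
    nlinarith

theorem wexp_overlap_le (h0 : 0 ≤ p) (h1 : p ≤ 1) {D : ℝ} (B : V → V → Bool)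
    (R C : Finset V) (hR : ∀ i ∈ R, IsLight D (B i)) :
    wexp (piWeight (bern p))
      (fun x => ∑ i ∈ R, (#({j ∈ C | x j = true ∧ B i j = true}.offDiag) : ℝ)) ≤
      #R * (D ^ 2 * p ^ 2) := by
  rw [wexp_sum, ← nsmul_eq_mul]
  refine sum_le_card_nsmul _ _ _ fun i hi => ?_
  have hw : IsWeight (piWeight (bern p) : (V → Bool) → ℝ) := (isWeight_bern h0 h1).piWeight
  set T : Finset V := {j | B i j = true} with hT
  have hTD : (#T : ℝ) ≤ D := hR i hi
  have hle : ∀ x : V → Bool, (#({j ∈ C | x j = true ∧ B i j = true}.offDiag) : ℝ) ≤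
      ∑ z ∈ T.offDiag, if x z.1 = true ∧ x z.2 = true then 1 else 0 := by
    intro x
    rw [← natCast_card_filter]
    refine Nat.cast_le.2 (card_le_card fun z hz => ?_)
    simp only [mem_offDiag, mem_filter, hT, mem_univ, true_and] at hz ⊢
    tauto
  refine (wexp_mono hw hle).trans ?_
  rw [wexp_sum]
  have heq : ∀ z ∈ T.offDiag, wexp (piWeight (bern p))
      (fun x : V → Bool => if x z.1 = true ∧ x z.2 = true then (1 : ℝ) else 0) ≤ p ^ 2 := by
    intro z hz
    refine le_trans (le_of_eq ?_) (wprob_true_true h0 h1 (mem_offDiag.1 hz).2.2).le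
    unfold wprob
    congr! 3
  refine (sum_le_card_nsmul _ _ _ heq).trans ?_
  rw [nsmul_eq_mul]
  refine mul_le_mul_of_nonneg_right ?_ (sq_nonneg p)
  have : (#T.offDiag : ℝ) ≤ #T * #T := by
    rw [offDiag_card]
    exact_mod_cast Nat.sub_le _ _
  nlinarith [(Nat.cast_nonneg (#T) : (0 : ℝ) ≤ #T)]

/-- A random set of columns meets many light rows. -/
theorem wprob_reached_lt_le (h0 : 0 ≤ p) (h1 : p ≤ 1) {D s t z : ℝ} (hs : 0 ≤ s) (hz : 0 < z)
    (B : V → V → Bool) (R C : Finset V) (hR : ∀ i ∈ R, IsLight D (B i))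
    (hC : ∀ j ∈ C, s ≤ #{i ∈ R | B i j = true}) :
    wprob (piWeight (bern p)) (fun x : V → Bool =>
      (#{i ∈ R | ∃ j ∈ C, x j = true ∧ B i j = true} : ℝ) < s * t - z) ≤
      Real.exp (t - p * #C / 2) + #R * (D ^ 2 * p ^ 2) / z := by
  have hw : IsWeight (piWeight (bern p) : (V → Bool) → ℝ) := (isWeight_bern h0 h1).piWeight
  refine le_trans ?_ (add_le_add (wprob_card_le h0 h1 C t)
    ((wprob_le_wexp_div hw (fun x => sum_nonneg fun i _ => Nat.cast_nonneg _) hz).trans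
      (div_le_div_of_nonneg_right (wexp_overlap_le h0 h1 B R C hR) hz.le)))
  refine (wprob_mono hw fun x hx => ?_).trans (wprob_or_le hw _ _)
  by_contra! hcon
  obtain ⟨ht, hov⟩ := hcon
  have hrow : ∀ i ∈ R, (#{j ∈ C | x j = true ∧ B i j = true} : ℝ) -
      #({j ∈ C | x j = true ∧ B i j = true}.offDiag) ≤
        if ∃ j ∈ C, x j = true ∧ B i j = true then 1 else 0 := by
    intro i _
    set d := #{j ∈ C | x j = true ∧ B i j = true} with hd
    rw [offDiag_card, ← hd, Nat.cast_sub (Nat.le_mul_self d)]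
    split_ifs with h
    · push_cast
      nlinarith [sq_nonneg ((d : ℝ) - 1)]
    · push Not at h
      have : d = 0 := by
        rw [hd, card_eq_zero, filter_eq_empty_iff]
        rintro j hj ⟨h1, h2⟩
        exact h j hj h1 h2
      simp [this]
  have hsum := sum_le_sum hrow
  rw [sum_sub_distrib, ← natCast_card_filter] at hsum
  have hdouble : ∑ i ∈ R, (#{j ∈ C | x j = true ∧ B i j = true} : ℝ) =
      ∑ j ∈ {j ∈ C | x j = true}, (#{i ∈ R | B i j = true} : ℝ) := by
    simp only [natCast_card_filter, sum_filter, ite_and]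
    rw [sum_comm]
    refine sum_congr rfl fun j _ => ?_
    split_ifs <;> simp
  have hlow : s * #{j ∈ C | x j = true} ≤
      ∑ j ∈ {j ∈ C | x j = true}, (#{i ∈ R | B i j = true} : ℝ) := by
    rw [mul_comm, ← nsmul_eq_mul]
    exact card_nsmul_le_sum _ _ _ fun j hj => hC j (mem_filter.1 hj).1
  nlinarith [mul_le_mul_of_nonneg_left ht.le hs]

/-- The numerical constraints on the size `n`, the density `p` and the auxiliary size `m` under
which stable 4-cycles are extremely likely. -/
structure StableRegime (n p : ℝ) (m : ℕ) : Prop where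
  p_nonneg : 0 ≤ p
  p_le_one : p ≤ 1
  le_mean_degree : 2400 ≤ n * p
  mean_codegree_le : n * p ^ 2 ≤ Real.exp (-104) / 65536
  le_mean_paths : 2 ^ 27 ≤ n ^ 2 * p ^ 3
  le_p_mul : 200 ≤ p * m
  p_mul_le : p * m ≤ 201
  entropy_le : 2 * m * Real.log n ≤ n

namespace StableRegime

variable {n p : ℝ} {m : ℕ}

theorem p_pos (h : StableRegime n p m) : 0 < p :=
  lt_of_le_of_ne h.p_nonneg fun h0 => by have := h.le_mean_degree; rw [← h0] at this; norm_num at this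

theorem n_pos (h : StableRegime n p m) : 0 < n := by
  have := h.le_mean_degree
  have := h.p_pos
  by_contra! hn
  nlinarith

theorem m_le (h : StableRegime n p m) : (m : ℝ) ≤ n / 6 := by
  have h1 := h.le_mean_degree
  have h2 := h.p_mul_le
  refine le_of_mul_le_mul_left ?_ h.p_pos
  nlinarith

theorem m_le_sq (h : StableRegime n p m) : (m : ℝ) ≤ n ^ 2 * p ^ 2 / 768 := by
  have h1 := h.le_mean_paths
  have h2 := h.p_mul_le
  refine le_of_mul_le_mul_left ?_ h.p_pos
  nlinarith

theorem two_mul_exp_le : 2 * Real.exp (-100) ≤ Real.exp (-99) := by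
  have h : Real.exp (-99) = Real.exp 1 * Real.exp (-100) := by
    rw [← Real.exp_add]; norm_num
  rw [h]
  nlinarith [Real.add_one_le_exp (1 : ℝ), Real.exp_pos (-100)]

theorem exp_neg_104_le : Real.exp (-104) ≤ Real.exp (-100) :=
  Real.exp_le_exp.2 (by norm_num)

theorem hit_error_le (h : StableRegime n p m) :
    Real.exp (-(p * m / 2)) + m * (4 * n * p * p ^ 2) ≤ Real.exp (-99) := by
  have h1 : Real.exp (-(p * m / 2)) ≤ Real.exp (-100) :=
    Real.exp_le_exp.2 (by linarith [h.le_p_mul])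
  have h2 : m * (4 * n * p * p ^ 2) ≤ 804 * (Real.exp (-104) / 65536) := by
    have h3 : 0 ≤ n * p ^ 2 := mul_nonneg h.n_pos.le (sq_nonneg p)
    nlinarith [h.p_mul_le, h.mean_codegree_le]
  linarith [two_mul_exp_le, exp_neg_104_le, Real.exp_pos (-104)]

theorem reach_error_le (h : StableRegime n p m) :
    Real.exp (n * p / 24 - n * p / 12) +
      n * ((4 * n * p) ^ 2 * p ^ 2) / (n ^ 2 * p ^ 2 / 768) ≤ Real.exp (-99) := by
  have h1 : Real.exp (n * p / 24 - n * p / 12) ≤ Real.exp (-100) :=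
    Real.exp_le_exp.2 (by linarith [h.le_mean_degree])
  have h2 : n * ((4 * n * p) ^ 2 * p ^ 2) / (n ^ 2 * p ^ 2 / 768) = 12288 * (n * p ^ 2) := by
    have := h.n_pos
    have := h.p_pos
    field_simp
    norm_num
  rw [h2]
  linarith [two_mul_exp_le, exp_neg_104_le, Real.exp_pos (-104), h.mean_codegree_le]

end StableRegime

/-- The rows `i₁ ∈ S` joined to the row `i₂` by a path `i₂ → j₁ → i₁` through a column
`j₁ ∈ S`. Here `A` is given by columns and `B` by rows. -/
noncomputable def bridges (D : ℝ) (S : Finset V) (A B : V → V → Bool) (i₂ : V) : Finset V :=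
  {i₁ ∈ S | IsLight D (B i₁) ∧ ∃ j₁ ∈ S, IsLight D (A j₁) ∧ A j₁ i₂ = true ∧ B i₁ j₁ = true}

/-- Every large set of rows has many neighbours among the columns of `S`. -/
def ColumnsDense (p : ℝ) (S : Finset V) (B : V → V → Bool) : Prop :=
  ∀ R : Finset V, (Fintype.card V : ℝ) / 4 ≤ #R →
    (#{j ∈ S | (#{i ∈ R | B i j = true} : ℝ) ≤ p * Fintype.card V / 16} : ℝ) <
      Fintype.card V / 12

theorem wprob_few_bridges_le {m : ℕ} (h : StableRegime (Fintype.card V) p m) {S : Finset V}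
    (hS : (Fintype.card V : ℝ) / 3 ≤ #S) (B : V → V → Bool)
    (hB : (#{i ∈ S | ¬ IsLight (4 * Fintype.card V * p) (B i)} : ℝ) < Fintype.card V / 12)
    (hdense : ColumnsDense p S B) :
    wprob (piWeight (piWeight (bern p))) (fun A : V → V → Bool =>
      (#{j ∈ S | ¬ IsLight (4 * Fintype.card V * p) (A j)} : ℝ) < Fintype.card V / 12 ∧
      (Fintype.card V : ℝ) / 6 ≤
        #{i ∈ Sᶜ | ¬ m ≤ #(bridges (4 * Fintype.card V * p) S A B i)}) ≤
      Real.exp (2 * Fintype.card V - 99 * (Fintype.card V / 6)) := by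
  have hb := isWeight_bern h.p_nonneg h.p_le_one
  have hp := h.p_pos
  set n : ℝ := (Fintype.card V : ℝ)
  have hn0 : 0 < n := h.n_pos
  set D : ℝ := 4 * n * p with hD
  set R : Finset V := {i ∈ S | IsLight D (B i)} with hR
  have hRcard : n / 4 ≤ #R := by
    have := card_filter_add_card_filter_not (s := S) (fun i => IsLight D (B i))
    have : (#R : ℝ) + #{i ∈ S | ¬ IsLight D (B i)} = #S := by exact_mod_cast this
    linarith
  have hexists := wprob_exists_le_card hb.piWeight.piWeight
    ({H : Finset V | (#H : ℝ) < n / 12} : Finset (Finset V))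
    (fun H (A : V → V → Bool) => n / 6 ≤ #{i ∈ Sᶜ |
      ¬ m ≤ #{i₁ ∈ R | ∃ j ∈ S \ H, A j i = true ∧ B i₁ j = true}})
    (q := Real.exp (n - 99 * (n / 6))) fun H hH => ?_
  · refine (wprob_mono hb.piWeight.piWeight fun A hA => ?_).trans (hexists.trans ?_)
    · refine ⟨{j ∈ S | ¬ IsLight D (A j)}, by simpa using hA.1, hA.2.trans ?_⟩
      refine Nat.cast_le.2 (card_le_card fun i => ?_)
      simp only [mem_filter]
      refine And.imp_right fun hi hm => hi (hm.trans (card_le_card fun i₁ => ?_))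
      simp only [bridges, hR, mem_filter, Finset.mem_sdiff]
      rintro ⟨⟨hi₁, hl⟩, j, ⟨hj, hjl⟩, hA, hB⟩
      exact ⟨hi₁, hl, j, hj, by_contra fun hc => hjl ⟨hj, hc⟩, hA, hB⟩
    · refine (mul_le_mul_of_nonneg_right (card_finset_le_exp _) (Real.exp_pos _).le).trans ?_
      rw [← Real.exp_add]
      exact Real.exp_le_exp.2 (by linarith)
  · rw [mem_filter_univ] at hH
    rw [wprob_piWeight_flip]
    refine wprob_piWeight_count_le hb.piWeight Sᶜ
      (fun _ x => ¬ m ≤ #{i₁ ∈ R | ∃ j ∈ S \ H, x j = true ∧ B i₁ j = true})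
      (by norm_num) _ fun i _ => ?_
    set C : Finset V := {j ∈ S \ H | ¬ (#{i ∈ R | B i j = true} : ℝ) ≤ p * n / 16} with hC
    have hCcard : n / 6 ≤ #C := by
      have h1 : #S ≤ #C + #{j ∈ S | (#{i ∈ R | B i j = true} : ℝ) ≤ p * n / 16} + #H := by
        refine (card_le_card fun j hj => ?_).trans
          ((card_union_le _ _).trans (Nat.add_le_add_right (card_union_le _ _) _))
        simp only [hC, mem_union, mem_filter, Finset.mem_sdiff]
        tauto
      have h2 := hdense R hRcard
      have h3 : (#S : ℝ) ≤ #C + #{j ∈ S | (#{i ∈ R | B i j = true} : ℝ) ≤ p * n / 16} + #H := by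
        exact_mod_cast h1
      linarith
    have hreach := wprob_reached_lt_le h.p_nonneg h.p_le_one (D := D) (s := p * n / 16)
      (t := n * p / 24) (z := n ^ 2 * p ^ 2 / 768) (by positivity) (by positivity) B R C
      (fun i hi => (mem_filter.1 hi).2) (fun j hj => (not_le.1 (mem_filter.1 hj).2).le)
    refine (wprob_mono hb.piWeight fun x hx => ?_).trans
      (hreach.trans (le_trans (add_le_add ?_ ?_) h.reach_error_le))
    · have h1 : (#{i ∈ R | ∃ j ∈ C, x j = true ∧ B i j = true} : ℝ) < m := by
        rw [not_le] at hx
        refine Nat.cast_lt.2 (lt_of_le_of_lt (card_le_card fun i => ?_) hx)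
        simp only [mem_filter, hC]
        rintro ⟨hi, j, ⟨hj, -⟩, hxB⟩
        exact ⟨hi, j, hj, hxB⟩
      have h2 := h.m_le_sq
      linarith
    · refine Real.exp_le_exp.2 ?_
      nlinarith
    · refine div_le_div_of_nonneg_right (mul_le_mul_of_nonneg_right ?_ (by positivity))
        (by positivity)
      exact Nat.cast_le.2 (card_le_univ R)

/-- Every system of `m` entries `(f k, g k)` in distinct rows and light columns of `S` leads to
most columns outside `S` along a path which is stable with respect to `A`. -/
def PathsSpread (D : ℝ) (S : Finset V) (m : ℕ) (A : V → V → Bool) : Prop :=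
  ∀ f g : Fin m → V, Function.Injective f → (∀ k, g k ∈ S ∧ IsLight D (A (g k))) →
    (#{j ∈ Sᶜ | ¬ ∃ k, A j (f k) = true ∧ ∀ i ≠ f k, ¬ (A (g k) i = true ∧ A j i = true)} : ℝ) <
      Fintype.card V / 6

theorem wprob_not_pathsSpread_le {m : ℕ} (h : StableRegime (Fintype.card V) p m) (S : Finset V) :
    wprob (piWeight (piWeight (bern p)))
      (fun A : V → V → Bool => ¬ PathsSpread (4 * Fintype.card V * p) S m A) ≤
      Real.exp (2 * Fintype.card V - 99 * (Fintype.card V / 6)) := by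
  have hb := isWeight_bern h.p_nonneg h.p_le_one
  refine wprob_piWeight_le_of_resample hb.piWeight S _ fun y => ?_
  set n : ℝ := (Fintype.card V : ℝ)
  have hn0 : 0 < n := h.n_pos
  set D : ℝ := 4 * n * p with hD
  have hexists := wprob_exists_le_card hb.piWeight.piWeight
    ({z | Function.Injective z.1 ∧ ∀ k, z.2 k ∈ S ∧ IsLight D (y (z.2 k))} :
      Finset ((Fin m → V) × (Fin m → V)))
    (fun z (x : V → V → Bool) => n / 6 ≤ #{j ∈ Sᶜ | ¬ ∃ k, x j (z.1 k) = true ∧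
      ∀ i ≠ z.1 k, ¬ (y (z.2 k) i = true ∧ x j i = true)})
    (q := Real.exp (n - 99 * (n / 6))) fun z hz => ?_
  · refine (wprob_mono hb.piWeight.piWeight fun x hx => ?_).trans (hexists.trans ?_)
    · simp only [PathsSpread, not_forall, not_lt] at hx
      obtain ⟨f, g, hf, hg, hfail⟩ := hx
      have hyg : ∀ k, S.piecewise y x (g k) = y (g k) := fun k => by simp [(hg k).1]
      simp only [hyg] at hg hfail
      refine ⟨(f, g), by simpa using ⟨hf, hg⟩, hfail.trans_eq ?_⟩
      congr 2
      refine filter_congr fun j hj => ?_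
      rw [piecewise_eq_of_notMem _ _ _ (mem_compl.1 hj)]
    · have hcard : (#({z | Function.Injective z.1 ∧ ∀ k, z.2 k ∈ S ∧ IsLight D (y (z.2 k))} :
          Finset ((Fin m → V) × (Fin m → V))) : ℝ) ≤ Real.exp n := by
        refine (Nat.cast_le.2 (card_le_univ _)).trans ?_
        rw [Fintype.card_prod, Fintype.card_fun, Fintype.card_fin, ← pow_add]
        push_cast
        rw [← Real.exp_log (pow_pos hn0 _), Real.log_pow]
        refine Real.exp_le_exp.2 (le_trans (le_of_eq ?_) h.entropy_le)
        push_cast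
        ring
      refine (mul_le_mul_of_nonneg_right hcard (Real.exp_pos _).le).trans ?_
      rw [← Real.exp_add]
      exact Real.exp_le_exp.2 (by linarith)
  · rw [mem_filter_univ] at hz
    refine wprob_piWeight_count_le hb.piWeight Sᶜ (fun _ x => ¬ ∃ k, x (z.1 k) = true ∧
      ∀ i ≠ z.1 k, ¬ (y (z.2 k) i = true ∧ x i = true)) (by norm_num) _ fun j _ => ?_
    have hhit := wprob_no_isolated_hit_le h.p_nonneg h.p_le_one (univ : Finset (Fin m))
      hz.1.injOn (fun k => {i | i ≠ z.1 k ∧ y (z.2 k) i = true}) (D := D)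
      (fun k _ => le_trans (Nat.cast_le.2 (card_le_card fun i => ?_)) (hz.2 k).2)
      (fun k _ => by simp)
    · rw [card_univ, Fintype.card_fin] at hhit
      refine (wprob_mono hb.piWeight fun x hx => ?_).trans (hhit.trans h.hit_error_le)
      rintro ⟨k, -, hk, hk'⟩
      refine hx ⟨k, hk, fun i hi hyx => ?_⟩
      have := hk' i (by simp [hi, hyx.1])
      simp [hyx.2] at this
    · simp only [mem_filter]
      tauto

/-- The row `x`, put at position `i₂ ∉ S`, closes a stable 4-cycle through a row and a column
of `S`. -/
def Closes (S : Finset V) (A B : V → V → Bool) (i₂ : V) (x : V → Bool) : Prop :=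
  ∃ i₁ ∈ S, ∃ j₁ ∈ S, ∃ j₂ ∈ Sᶜ, A j₁ i₂ = true ∧ B i₁ j₁ = true ∧ A j₂ i₁ = true ∧
    (∀ i ≠ i₁, ¬ (A j₁ i = true ∧ A j₂ i = true)) ∧ x j₂ = true ∧
    ∀ j ≠ j₂, ¬ (B i₁ j = true ∧ x j = true)

theorem wprob_not_closes_le {m : ℕ} (h : StableRegime (Fintype.card V) p m) {S : Finset V}
    (hS : (Fintype.card V : ℝ) / 3 ≤ #Sᶜ) {A B : V → V → Bool}
    (hA : PathsSpread (4 * Fintype.card V * p) S m A) {i₂ : V}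
    (hi₂ : m ≤ #(bridges (4 * Fintype.card V * p) S A B i₂)) :
    wprob (piWeight (bern p)) (fun x : V → Bool => ¬ Closes S A B i₂ x) ≤ Real.exp (-99) := by
  have hb := isWeight_bern h.p_nonneg h.p_le_one
  set n : ℝ := (Fintype.card V : ℝ)
  set D : ℝ := 4 * n * p with hD
  obtain ⟨M, hM, hMm⟩ := exists_subset_card_eq hi₂
  set e := M.equivFinOfCardEq hMm
  have hbr : ∀ k, (e.symm k : V) ∈ S ∧ IsLight D (B (e.symm k)) ∧
      ∃ j₁ ∈ S, IsLight D (A j₁) ∧ A j₁ i₂ = true ∧ B (e.symm k) j₁ = true := by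
    intro k
    simpa [bridges] using hM (e.symm k).2
  choose hfS hfl g hgS hgl hgA hgB using hbr
  have hlt := hA (fun k => e.symm k) g (Subtype.val_injective.comp e.symm.injective)
    fun k => ⟨hgS k, hgl k⟩
  have hcompl := card_filter_add_card_filter_not (s := Sᶜ) fun j => ∃ k : Fin m,
    A j (e.symm k) = true ∧ ∀ i ≠ (e.symm k : V), ¬ (A (g k) i = true ∧ A j i = true)
  have hlarge : m ≤ #{j ∈ Sᶜ | ∃ k : Fin m,
      A j (e.symm k) = true ∧ ∀ i ≠ (e.symm k : V), ¬ (A (g k) i = true ∧ A j i = true)} := by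
    have h1 := h.m_le
    have h2 := congrArg (Nat.cast : ℕ → ℝ) hcompl
    rw [Nat.cast_add] at h2
    rw [← Nat.cast_le (α := ℝ)]
    linarith
  obtain ⟨G, hG, hGm⟩ := exists_subset_card_eq hlarge
  have hGk : ∀ j : V, ∃ k : Fin m, j ∈ G → j ∈ Sᶜ ∧
      A j (e.symm k) = true ∧ ∀ i ≠ (e.symm k : V), ¬ (A (g k) i = true ∧ A j i = true) := by
    intro j
    by_cases hj : j ∈ G
    · obtain ⟨hjS, k, hk⟩ := mem_filter.1 (hG hj)
      exact ⟨k, fun _ => ⟨hjS, hk⟩⟩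
    · have hm : 0 < m := by
        have := h.le_p_mul
        by_contra! hm
        simp only [Nat.le_zero.1 hm] at this
        norm_num at this
      exact ⟨⟨0, hm⟩, fun hj' => absurd hj' hj⟩
  choose k hk using hGk
  have hhit := wprob_no_isolated_hit_le h.p_nonneg h.p_le_one G (u := id)
    Function.injective_id.injOn (fun j => {v | v ≠ j ∧ B (e.symm (k j)) v = true}) (D := D)
    (fun j _ => le_trans (Nat.cast_le.2 (card_le_card fun i => ?_)) (hfl (k j)))
    (fun j _ => by simp)
  · rw [hGm] at hhit
    refine (wprob_mono hb.piWeight fun x hx => ?_).trans (hhit.trans h.hit_error_le)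
    rintro ⟨j, hj, hxj, hx'⟩
    obtain ⟨hjS, hjA, hjst⟩ := hk j hj
    refine hx ⟨_, hfS (k j), g (k j), hgS _, j, hjS, hgA _, hgB _, hjA, hjst, hxj,
      fun v hv hvx => ?_⟩
    have := hx' v (by simp [hv, hvx.1])
    simp [hvx.2] at this
  · simp only [mem_filter]
    tauto

/-- There is a 4-cycle which is stable in a sense slightly stronger than `IsStableCycle`. -/
def HasStableFourCycle (A B : V → V → Bool) : Prop :=
  ∃ i₁ i₂ j₁ j₂, i₁ ≠ i₂ ∧ j₁ ≠ j₂ ∧ B i₁ j₁ = true ∧ B i₂ j₂ = true ∧ A j₁ i₂ = true ∧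
    A j₂ i₁ = true ∧ (∀ i ≠ i₁, ¬ (A j₁ i = true ∧ A j₂ i = true)) ∧
    ∀ j ≠ j₂, ¬ (B i₁ j = true ∧ B i₂ j = true)

theorem wprob_not_closed_le {m : ℕ} (h : StableRegime (Fintype.card V) p m) {S : Finset V}
    (hS : (Fintype.card V : ℝ) / 3 ≤ #Sᶜ) {A : V → V → Bool}
    (hA : PathsSpread (4 * Fintype.card V * p) S m A) :
    wprob (piWeight (piWeight (bern p))) (fun B : V → V → Bool =>
      ((Fintype.card V : ℝ) / 6 ≤ #{i ∈ Sᶜ | m ≤ #(bridges (4 * Fintype.card V * p) S A B i)}) ∧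
        ¬ HasStableFourCycle A B) ≤ Real.exp (-(99 * (Fintype.card V / 6))) := by
  have hb := isWeight_bern h.p_nonneg h.p_le_one
  refine wprob_piWeight_le_of_resample hb.piWeight S _ fun y => ?_
  have hbr : ∀ (x : V → V → Bool) i, bridges (4 * Fintype.card V * p) S A (S.piecewise y x) i =
      bridges (4 * Fintype.card V * p) S A y i := by
    intro x i
    refine filter_congr fun i₁ hi₁ => ?_
    rw [piecewise_eq_of_mem _ _ _ hi₁]
  simp only [hbr]
  by_cases hlarge : (Fintype.card V : ℝ) / 6 ≤
      #{i ∈ Sᶜ | m ≤ #(bridges (4 * Fintype.card V * p) S A y i)}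
  · refine (wprob_mono hb.piWeight.piWeight fun x hx => ?_).trans
      (wprob_piWeight_forall_le hb.piWeight _ (fun i x => ¬ Closes S A y i x) (by norm_num) hlarge
        fun i hi => wprob_not_closes_le h hS hA (mem_filter.1 hi).2)
    rintro i₂ hi₂ ⟨i₁, hi₁, j₁, hj₁, j₂, hj₂, h1, h2, h3, h4, h5, h6⟩
    have hi₂' := mem_compl.1 (mem_filter.1 hi₂).1
    have hj₂' := mem_compl.1 hj₂
    refine hx.2 ⟨i₁, i₂, j₁, j₂, by rintro rfl; exact hi₂' hi₁, by rintro rfl; exact hj₂' hj₁, ?_⟩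
    rw [piecewise_eq_of_mem _ _ _ hi₁, piecewise_eq_of_notMem _ _ _ hi₂']
    exact ⟨h2, h5, h1, h3, h4, h6⟩
  · simp only [hlarge, false_and, wprob_false]
    positivity

theorem wprob_not_hasStableFourCycle_le {m : ℕ} (h : StableRegime (Fintype.card V) p m)
    {S : Finset V} (hS : (Fintype.card V : ℝ) / 3 ≤ #S)
    (hS' : (Fintype.card V : ℝ) / 3 ≤ #Sᶜ) :
    wprob (prodWeight (piWeight (piWeight (bern p))) (piWeight (piWeight (bern p))))
      (fun z : (V → V → Bool) × (V → V → Bool) => ¬ HasStableFourCycle z.1 z.2) ≤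
      6 * Real.exp (-2 * Fintype.card V) := by
  have hw : IsWeight (piWeight (piWeight (bern p)) : (V → V → Bool) → ℝ) :=
    (isWeight_bern h.p_nonneg h.p_le_one).piWeight.piWeight
  have hww := hw.prodWeight hw
  have hnp := h.le_mean_degree
  have hheavy := wprob_heavy_count_le h.p_nonneg h.p_le_one S (Fintype.card V / 12 : ℝ)
  have hdense := wprob_sparse_columns_le h.p_nonneg h.p_le_one S (Fintype.card V / 12 : ℝ)
  have hspread := wprob_not_pathsSpread_le h S
  set n : ℝ := (Fintype.card V : ℝ)
  have hn0 : 0 < n := h.n_pos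
  set D : ℝ := 4 * n * p with hD
  set E₀ : (V → V → Bool) → Prop := fun A => n / 12 ≤ #{j ∈ S | ¬ IsLight D (A j)}
  set E₁ : (V → V → Bool) → Prop := fun B => ∃ R : Finset V, n / 4 ≤ #R ∧
    n / 12 ≤ #{j ∈ S | (#{i ∈ R | B i j = true} : ℝ) ≤ p * n / 16}
  set E₂ : (V → V → Bool) → (V → V → Bool) → Prop := fun A B =>
    n / 6 ≤ #{i ∈ Sᶜ | m ≤ #(bridges D S A B i)}
  set E₃ : (V → V → Bool) → Prop := fun A => PathsSpread D S m A
  have b1 : wprob (prodWeight (piWeight (piWeight (bern p))) (piWeight (piWeight (bern p))))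
      (fun z : (V → V → Bool) × (V → V → Bool) => E₀ z.1) ≤ Real.exp (-2 * n) :=
    wprob_prod_le_left hw (P := fun A _ => E₀ A) fun _ =>
      hheavy.trans (Real.exp_le_exp.2 (by nlinarith))
  have b2 : wprob (prodWeight (piWeight (piWeight (bern p))) (piWeight (piWeight (bern p))))
      (fun z : (V → V → Bool) × (V → V → Bool) => E₀ z.2) ≤ Real.exp (-2 * n) :=
    wprob_prod_le_right hw (P := fun _ B => E₀ B) fun _ =>
      hheavy.trans (Real.exp_le_exp.2 (by nlinarith))
  have b3 : wprob (prodWeight (piWeight (piWeight (bern p))) (piWeight (piWeight (bern p))))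
      (fun z : (V → V → Bool) × (V → V → Bool) => E₁ z.2) ≤ Real.exp (-2 * n) :=
    wprob_prod_le_right hw (P := fun _ B => E₁ B) fun _ =>
      hdense.trans (Real.exp_le_exp.2 (by nlinarith))
  have b4 : wprob (prodWeight (piWeight (piWeight (bern p))) (piWeight (piWeight (bern p))))
      (fun z : (V → V → Bool) × (V → V → Bool) => ¬ E₃ z.1) ≤ Real.exp (-2 * n) :=
    wprob_prod_le_left hw (P := fun A _ => ¬ E₃ A) fun _ =>
      hspread.trans (Real.exp_le_exp.2 (by linarith))
  have b5 : wprob (prodWeight (piWeight (piWeight (bern p))) (piWeight (piWeight (bern p))))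
      (fun z : (V → V → Bool) × (V → V → Bool) =>
        ¬ E₀ z.2 ∧ ¬ E₁ z.2 ∧ ¬ E₀ z.1 ∧ ¬ E₂ z.1 z.2) ≤ Real.exp (-2 * n) := by
    refine wprob_prod_le_left hw
      (P := fun A B => ¬ E₀ B ∧ ¬ E₁ B ∧ ¬ E₀ A ∧ ¬ E₂ A B) fun B => ?_
    by_cases hB₀ : E₀ B
    · simp only [hB₀, not_true_eq_false, false_and, wprob_false]
      positivity
    by_cases hB₁ : E₁ B
    · simp only [hB₁, not_true_eq_false, false_and, and_false, wprob_false]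
      positivity
    have hdenseB : ColumnsDense p S B := by
      intro R hR
      by_contra! hcon
      exact hB₁ ⟨R, hR, hcon⟩
    have hfew := wprob_few_bridges_le h hS B (not_le.1 hB₀) hdenseB
    refine (wprob_mono hw fun A hA => ⟨not_le.1 hA.2.2.1, ?_⟩).trans
      (hfew.trans (Real.exp_le_exp.2 (by linarith)))
    have h1 := card_filter_add_card_filter_not (s := Sᶜ) fun i => m ≤ #(bridges D S A B i)
    have h2 : (#{i ∈ Sᶜ | m ≤ #(bridges D S A B i)} : ℝ) +
        #{i ∈ Sᶜ | ¬ m ≤ #(bridges D S A B i)} = #Sᶜ := by exact_mod_cast h1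
    have h3 := not_le.1 hA.2.2.2
    linarith
  have b6 : wprob (prodWeight (piWeight (piWeight (bern p))) (piWeight (piWeight (bern p))))
      (fun z : (V → V → Bool) × (V → V → Bool) =>
        E₃ z.1 ∧ E₂ z.1 z.2 ∧ ¬ HasStableFourCycle z.1 z.2) ≤ Real.exp (-2 * n) := by
    refine wprob_prod_le_right hw
      (P := fun A B => E₃ A ∧ E₂ A B ∧ ¬ HasStableFourCycle A B) fun A => ?_
    by_cases hA : E₃ A
    · refine (wprob_mono hw fun B hB => hB.2).trans ((wprob_not_closed_le h hS' hA).trans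
        (Real.exp_le_exp.2 (by linarith)))
    · simp only [hA, false_and, wprob_false]
      positivity
  have hsplit : ∀ z : (V → V → Bool) × (V → V → Bool), ¬ HasStableFourCycle z.1 z.2 →
      E₀ z.1 ∨ E₀ z.2 ∨ E₁ z.2 ∨ ¬ E₃ z.1 ∨
        (¬ E₀ z.2 ∧ ¬ E₁ z.2 ∧ ¬ E₀ z.1 ∧ ¬ E₂ z.1 z.2) ∨
        (E₃ z.1 ∧ E₂ z.1 z.2 ∧ ¬ HasStableFourCycle z.1 z.2) := by
    intro z hz
    tauto
  refine (wprob_mono hww hsplit).trans ?_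
  refine (wprob_or_le hww _ _).trans ?_
  refine (add_le_add b1 ((wprob_or_le hww _ _).trans (add_le_add b2 ((wprob_or_le hww _ _).trans
    (add_le_add b3 ((wprob_or_le hww _ _).trans (add_le_add b4 ((wprob_or_le hww _ _).trans
      (add_le_add b5 b6))))))))).trans (le_of_eq ?_)
  ring

theorem toReal_gameMeasure {n : ℕ} (h0 : 0 ≤ p) (h1 : p ≤ 1)
    (s : Set ((Fin n → Fin n → Bool) × (Fin n → Fin n → Bool))) :
    (gameMeasure n p s).toReal =
      wprob (prodWeight (piWeight (piWeight (bern p))) (piWeight (piWeight (bern p))))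
        (· ∈ s) := by
  have hentry : ∀ b, (entryWeight p b).toReal = bern p b := by
    intro b
    cases b <;> simp [entryWeight, bern, h0, h1]
  have hweight : ∀ ω, (pairWeight n p ω).toReal =
      prodWeight (piWeight (piWeight (bern p))) (piWeight (piWeight (bern p))) ω := by
    intro ω
    simp only [pairWeight, ENNReal.toReal_mul, ENNReal.toReal_prod, hentry, prodWeight, piWeight]
  have hfin : ∀ ω, pairWeight n p ω ≠ ⊤ := by
    intro ω
    have h : ∀ b, entryWeight p b ≠ ⊤ := by
      intro b
      cases b <;> simp [entryWeight]
    exact ENNReal.mul_ne_top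
      (ENNReal.prod_ne_top fun i _ => ENNReal.prod_ne_top fun j _ => h _)
      (ENNReal.prod_ne_top fun i _ => ENNReal.prod_ne_top fun j _ => h _)
  have hs : MeasurableSet s := s.toFinite.measurableSet
  rw [gameMeasure, Measure.sum_apply _ hs, tsum_fintype, ENNReal.toReal_sum]
  · refine sum_congr rfl fun ω _ => ?_
    rw [Measure.smul_apply, Measure.dirac_apply' _ hs, smul_eq_mul, ENNReal.toReal_mul, hweight]
    by_cases h : ω ∈ s <;> simp [h]
  · intro ω _
    rw [Measure.smul_apply, Measure.dirac_apply' _ hs, smul_eq_mul]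
    refine ENNReal.mul_ne_top (hfin ω) ?_
    by_cases h : ω ∈ s <;> simp [h]

theorem wprob_flip_fst {w : X → ℝ} (P : (V → V → X) × (V → V → X) → Prop) :
    wprob (prodWeight (piWeight (piWeight w)) (piWeight (piWeight w))) P =
      wprob (prodWeight (piWeight (piWeight w)) (piWeight (piWeight w)))
        (fun z => P (fun i j => z.1 j i, z.2)) := by
  refine Fintype.sum_equiv ((Equiv.piComm fun _ _ => X).prodCongr (Equiv.refl _)) _ _ fun z => ?_
  congr 1
  simp only [prodWeight, piWeight, Equiv.prodCongr_apply, Prod.map, Equiv.piComm_apply,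
    Function.swap, Equiv.refl_apply]
  exact congrArg (· * _) Finset.prod_comm

theorem HasStableFourCycle.exists_isStableCycle {n : ℕ} {A B : Fin n → Fin n → Bool}
    (h : HasStableFourCycle (fun j i => A i j) B) :
    ∃ r c : ZMod 2 → Fin n, IsStableCycle 2 n A B r c := by
  obtain ⟨i₁, i₂, j₁, j₂, hi, hj, h1, h2, h3, h4, hA, hB⟩ := h
  have hcases : ∀ k : ZMod 2, k = 0 ∨ k = 1 := by decide
  refine ⟨fun k => if k = 0 then i₁ else i₂, fun k => if k = 0 then j₁ else j₂,
    ⟨?_, ?_, ?_, ?_⟩, ?_, ?_⟩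
  · intro k k' h
    rcases hcases k with rfl | rfl <;> rcases hcases k' with rfl | rfl <;> simp_all
  · intro k k' h
    rcases hcases k with rfl | rfl <;> rcases hcases k' with rfl | rfl <;> simp_all
  · intro k
    rcases hcases k with rfl | rfl <;> simpa
  · intro k
    have h11 : (1 + 1 : ZMod 2) = 0 := by decide
    rcases hcases k with rfl | rfl <;> simpa [h11]
  · intro i hir k k' hk hk'
    have hne : i ≠ i₁ := by
      rintro rfl
      exact hir ⟨0, by simp⟩
    have := hA i hne
    rcases hcases k with rfl | rfl <;> rcases hcases k' with rfl | rfl <;> simp_all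
  · intro j hjc k k' hk hk'
    have hne : j ≠ j₂ := by
      rintro rfl
      exact hjc ⟨1, by simp⟩
    have := hB j hne
    rcases hcases k with rfl | rfl <;> rcases hcases k' with rfl | rfl <;> simp_all

theorem toReal_gameMeasure_le_of_forall_not_isStableCycle {n m : ℕ} (hn : 2 ≤ n)
    (h : StableRegime n p m) {s : Set ((Fin n → Fin n → Bool) × (Fin n → Fin n → Bool))}
    (hs : ∀ ω ∈ s, ¬ ∃ r c : ZMod 2 → Fin n, IsStableCycle 2 n ω.1 ω.2 r c) :
    (gameMeasure n p s).toReal ≤ 6 * Real.exp (-2 * n) := by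
  rw [toReal_gameMeasure h.p_nonneg h.p_le_one, wprob_flip_fst]
  have hw : IsWeight (piWeight (piWeight (bern p)) : (Fin n → Fin n → Bool) → ℝ) :=
    (isWeight_bern h.p_nonneg h.p_le_one).piWeight.piWeight
  obtain ⟨S, -, hS⟩ := exists_subset_card_eq
    (show n / 2 ≤ #(univ : Finset (Fin n)) by rw [card_univ, Fintype.card_fin]; omega)
  have hS' : #Sᶜ = n - n / 2 := by rw [card_compl, Fintype.card_fin, hS]
  have h1 : (n : ℝ) / 3 ≤ #S := by
    rw [hS, div_le_iff₀ three_pos]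
    exact_mod_cast (show n ≤ n / 2 * 3 by omega)
  have h2 : (n : ℝ) / 3 ≤ #Sᶜ := by
    rw [hS', div_le_iff₀ three_pos]
    exact_mod_cast (show n ≤ (n - n / 2) * 3 by omega)
  have hmain := wprob_not_hasStableFourCycle_le (V := Fin n) (p := p) (m := m) (S := S)
    (by rwa [Fintype.card_fin]) (by rwa [Fintype.card_fin]) (by rwa [Fintype.card_fin])
  rw [Fintype.card_fin] at hmain
  refine le_trans (wprob_mono (hw.prodWeight hw) fun z hz => ?_) hmain
  exact fun hc => hs _ hz hc.exists_isStableCycle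

end FiniteProbability

theorem eventually_stableRegime {p : ℕ → ℝ} (hp : ∀ n, 0 ≤ p n ∧ p n ≤ 1)
    (hrange : ∀ᶠ n : ℕ in atTop,
      2 ^ 9 * (n : ℝ) ^ (-(2 : ℝ) / 3) ≤ p n ∧
        p n ≤ Real.exp (-52) / 2 ^ 8 * (n : ℝ) ^ (-(1 : ℝ) / 2)) :
    ∀ᶠ n : ℕ in atTop, StableRegime n (p n) ⌈200 / p n⌉₊ := by
  have hlog : ∀ᶠ x : ℝ in atTop, Real.log x ≤ x ^ ((1 : ℝ) / 3) := by
    have h := (isLittleO_log_rpow_atTop (show (0 : ℝ) < 1 / 3 by norm_num)).bound one_pos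
    filter_upwards [h, eventually_ge_atTop 1] with x hx hx1
    rw [one_mul, Real.norm_of_nonneg (Real.log_nonneg hx1),
      Real.norm_of_nonneg (by positivity)] at hx
    exact hx
  filter_upwards [hrange, tendsto_natCast_atTop_atTop.eventually hlog,
    eventually_ge_atTop 125] with n hr hl hn
  obtain ⟨hlow, hup⟩ := hr
  have hn' : (125 : ℝ) ≤ n := by exact_mod_cast hn
  have hn0 : (0 : ℝ) < n := by linarith
  set c : ℝ := (n : ℝ) ^ ((1 : ℝ) / 3) with hc
  have hc0 : 0 < c := by positivity
  have hc3 : c ^ 3 = n := by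
    rw [hc, ← Real.rpow_natCast, ← Real.rpow_mul hn0.le]
    norm_num
  have hc5 : 5 ≤ c := by
    by_contra! hlt
    have : c ^ 3 < 5 ^ 3 := pow_lt_pow_left₀ hlt hc0.le (by norm_num)
    linarith
  have hneg : (n : ℝ) ^ (-(2 : ℝ) / 3) = 1 / c ^ 2 := by
    rw [hc, ← Real.rpow_natCast, ← Real.rpow_mul hn0.le, one_div, ← Real.rpow_neg hn0.le]
    norm_num
  have hsq : ((n : ℝ) ^ (-(1 : ℝ) / 2)) ^ 2 = 1 / n := by
    rw [← Real.rpow_natCast, ← Real.rpow_mul hn0.le, one_div, ← Real.rpow_neg_one]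
    norm_num
  rw [hneg, mul_one_div] at hlow
  have hp0 : 0 < p n := lt_of_lt_of_le (by positivity) hlow
  have hpc : 2 ^ 9 ≤ p n * c ^ 2 := (div_le_iff₀ (by positivity)).1 hlow
  have hm1 : 200 / p n ≤ ⌈200 / p n⌉₊ := Nat.le_ceil _
  have hm2 : (⌈200 / p n⌉₊ : ℝ) < 200 / p n + 1 := Nat.ceil_lt_add_one (by positivity)
  have hm3 : p n * ⌈200 / p n⌉₊ ≤ 201 := by
    calc p n * ⌈200 / p n⌉₊ ≤ p n * (200 / p n + 1) := by gcongr
      _ = 200 + p n := by field_simp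
      _ ≤ 201 := by linarith [(hp n).2]
  refine ⟨hp0.le, (hp n).2, ?_, ?_, ?_, ?_, hm3, ?_⟩
  · rw [← hc3]
    nlinarith
  · calc (n : ℝ) * p n ^ 2 ≤ n * (Real.exp (-52) / 2 ^ 8 * (n : ℝ) ^ (-(1 : ℝ) / 2)) ^ 2 := by
          gcongr
      _ = Real.exp (-52) ^ 2 / 65536 := by
          rw [mul_pow, hsq]
          field_simp
          norm_num
      _ = Real.exp (-104) / 65536 := by
          rw [← Real.exp_nat_mul]
          norm_num
  · calc (2 : ℝ) ^ 27 = (2 ^ 9) ^ 3 := by norm_num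
      _ ≤ (p n * c ^ 2) ^ 3 := by gcongr
      _ = (n : ℝ) ^ 2 * p n ^ 3 := by
          rw [← hc3]
          ring
  · rw [mul_comm]
    exact (div_le_iff₀ hp0).1 hm1
  · set M : ℝ := (⌈200 / p n⌉₊ : ℝ)
    have hM0 : 0 ≤ M := Nat.cast_nonneg _
    have hMc : 2 * M ≤ c ^ 2 := by
      refine le_of_mul_le_mul_left ?_ hp0
      nlinarith
    calc 2 * M * Real.log n ≤ 2 * M * c := by gcongr
      _ ≤ c ^ 2 * c := by gcongr
      _ = n := by rw [← hc3]; ring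

theorem regime_two_failure_prob (p : ℕ → ℝ) (hp : ∀ n, 0 ≤ p n ∧ p n ≤ 1)
    (hrange : ∀ᶠ n : ℕ in atTop,
      2 ^ 9 * (n : ℝ) ^ (-(2 : ℝ) / 3) ≤ p n ∧
        p n ≤ Real.exp (-52) / 2 ^ 8 * (n : ℝ) ^ (-(1 : ℝ) / 2)) :
    Tendsto
      (fun n : ℕ => (2.598 : ℝ) ^ n *
        (gameMeasure n (p n)
          {ω | (¬ ∃ r c : ZMod 2 → Fin n, IsStableCycle 2 n ω.1 ω.2 r c) ∧
            ¬ ∃ i j : Fin n,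
              (∀ i' : Fin n, ω.1 i' j ≤ ω.1 i j) ∧
                (∀ j' : Fin n, ω.2 i j' ≤ ω.2 i j)}).toReal)
      atTop (nhds 0) := by
  have hrate : (2.598 : ℝ) * Real.exp (-2) < 1 := by
    rw [Real.exp_neg, ← div_eq_mul_inv, div_lt_one (Real.exp_pos _)]
    linarith [Real.add_one_le_exp (2 : ℝ)]
  have hlim : Tendsto (fun n : ℕ => 6 * ((2.598 : ℝ) * Real.exp (-2)) ^ n) atTop (nhds 0) := by
    simpa using (tendsto_pow_atTop_nhds_zero_of_lt_one (by positivity) hrate).const_mul 6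
  refine squeeze_zero' (Eventually.of_forall fun n => by positivity) ?_ hlim
  filter_upwards [eventually_stableRegime hp hrange, eventually_ge_atTop 2] with n hreg hn
  have hle : (gameMeasure n (p n)
      {ω | (¬ ∃ r c : ZMod 2 → Fin n, IsStableCycle 2 n ω.1 ω.2 r c) ∧
        ¬ ∃ i j : Fin n, (∀ i' : Fin n, ω.1 i' j ≤ ω.1 i j) ∧
          (∀ j' : Fin n, ω.2 i j' ≤ ω.2 i j)}).toReal ≤ 6 * Real.exp (-2 * n) :=
    toReal_gameMeasure_le_of_forall_not_isStableCycle hn hreg fun ω hω => hω.1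
  calc (2.598 : ℝ) ^ n * _ ≤ 2.598 ^ n * (6 * Real.exp (-2 * n)) := by gcongr
    _ = 6 * ((2.598 : ℝ) * Real.exp (-2)) ^ n := by
      rw [mul_pow, ← Real.exp_nat_mul, mul_comm (n : ℝ)]
      ring
end

section
/- Let n ∈ ℕ, p₀, p₁ ∈ [0,1], and δ ≥ 0. Let d₀ be a fixed bipartite digraph on parts R = {r_1,…,r_n} and C = {c_1,…,c_n}, and suppose H is a stable 4-cycle of d₀ with row set {i_1,i_2} and column set {j_1,j_2} such that each of the four vertices of H has out-degree strictly less than (1+δ) n p₀ in d₀. Let d be the random digraph obtained from d₀ by adding, independently with probability p₁ each, every arc between R and C (in either direction) that is not present in d₀, while keeping all arcs of d₀. Then the probability that H is not a stable 4-cycle of d is at most 2 n p₁² + 4(1+δ) n p₀ p₁. -/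
open MeasureTheory Filter Finset
open scoped ENNReal

/-- The Bernoulli measure on `Bool` giving mass `p` to `true`. -/
noncomputable def bernoulliMeasure (p : ℝ) : Measure Bool :=
  Measure.sum fun b => entryWeight p b • Measure.dirac b

/-- The law of an `ι × κ` Boolean matrix with i.i.d. Bernoulli entries. -/
noncomputable def bernoulliMatrixMeasure (ι κ : Type*) [Fintype ι] [Fintype κ] (p : ℝ) :
    Measure (ι → κ → Bool) :=
  Measure.pi fun _ => Measure.pi fun _ => bernoulliMeasure p

theorem sum_smul_dirac_singleton {α : Type*} [MeasurableSpace α]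
    [MeasurableSingletonClass α] (w : α → ℝ≥0∞) (a : α) :
    (Measure.sum fun b => w b • Measure.dirac b) {a} = w a := by
  classical
  rw [Measure.sum_apply _ (measurableSet_singleton a), tsum_eq_single a]
  · simp
  · intro b hb
    simp [hb]

theorem isProbabilityMeasure_bernoulliMeasure {p : ℝ} (hp : 0 ≤ p ∧ p ≤ 1) :
    IsProbabilityMeasure (bernoulliMeasure p) := by
  refine ⟨?_⟩
  rw [bernoulliMeasure, Measure.sum_apply _ MeasurableSet.univ]
  simp only [Measure.smul_apply, measure_univ, smul_eq_mul, mul_one, tsum_bool, entryWeight]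
  simp only [Bool.false_eq_true, if_false, if_true]
  rw [← ENNReal.ofReal_add (by linarith [hp.2]) hp.1]
  simp

theorem gameMeasure_eq_prod (n : ℕ) {p : ℝ} (hp : 0 ≤ p ∧ p ≤ 1) :
    gameMeasure n p = (bernoulliMatrixMeasure (Fin n) (Fin n) p).prod
      (bernoulliMatrixMeasure (Fin n) (Fin n) p) := by
  have := isProbabilityMeasure_bernoulliMeasure hp
  refine Measure.ext_of_singleton fun ω => ?_
  rw [gameMeasure, sum_smul_dirac_singleton, ← Set.singleton_prod_singleton (a := ω.1) (b := ω.2)]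
  unfold bernoulliMatrixMeasure
  rw [Measure.prod_prod]
  simp only [Measure.pi_singleton]
  simp only [bernoulliMeasure, sum_smul_dirac_singleton, pairWeight]

section Matrix

variable {ι κ : Type*} [Fintype ι] [Fintype κ]

theorem bernoulliMatrixMeasure_forall_mem {p : ℝ} (hp : 0 ≤ p ∧ p ≤ 1) (S : Finset (ι × κ)) :
    bernoulliMatrixMeasure ι κ p {M | ∀ x ∈ S, M x.1 x.2 = true} =
      ENNReal.ofReal (p ^ #S) := by
  classical
  have := isProbabilityMeasure_bernoulliMeasure hp
  have hset : {M : ι → κ → Bool | ∀ x ∈ S, M x.1 x.2 = true} =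
      Set.univ.pi fun i => Set.univ.pi fun j =>
        if (i, j) ∈ S then ({true} : Set Bool) else Set.univ := by
    ext M
    simp only [Set.mem_ofPred_eq, Set.mem_pi, Set.mem_univ, true_implies, Prod.forall]
    refine forall_congr' fun i => forall_congr' fun j => ?_
    by_cases h : (i, j) ∈ S <;> simp [h]
  have hentry : ∀ i j, bernoulliMeasure p
      (if (i, j) ∈ S then ({true} : Set Bool) else Set.univ) =
        if (i, j) ∈ S then ENNReal.ofReal p else 1 := by
    intro i j
    by_cases h : (i, j) ∈ S
    · simp [h, bernoulliMeasure, entryWeight]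
    · rw [if_neg h, if_neg h, measure_univ]
  rw [hset, bernoulliMatrixMeasure, Measure.pi_pi]
  simp only [Measure.pi_pi, hentry]
  rw [← Fintype.prod_prod_type' fun i j => if (i, j) ∈ S then ENNReal.ofReal p else 1]
  simp [Finset.prod_ite_mem, ENNReal.ofReal_pow hp.1]

/-- The probability that sprinkling makes two distinct entries of a Boolean matrix, not both
`true` at the start, simultaneously `true`. -/
theorem bernoulliMatrixMeasure_sprinkle_pair_le {p : ℝ} (hp : 0 ≤ p ∧ p ≤ 1)
    (M₀ : ι → κ → Bool) {x y : ι × κ} (hxy : x ≠ y)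
    (hM₀ : ¬ (M₀ x.1 x.2 = true ∧ M₀ y.1 y.2 = true)) :
    bernoulliMatrixMeasure ι κ p
        {M | (M₀ x.1 x.2 || M x.1 x.2) = true ∧ (M₀ y.1 y.2 || M y.1 y.2) = true} ≤
      ENNReal.ofReal (p ^ 2 + (if M₀ x.1 x.2 = true then p else 0) +
        (if M₀ y.1 y.2 = true then p else 0)) := by
  classical
  by_cases hx : M₀ x.1 x.2 = true
  · have hy : ¬ M₀ y.1 y.2 = true := fun h => hM₀ ⟨hx, h⟩
    calc _ = bernoulliMatrixMeasure ι κ p {M | ∀ z ∈ ({y} : Finset (ι × κ)), M z.1 z.2 = true} := by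
          simp [hx, hy]
      _ = ENNReal.ofReal (p ^ 1) := by rw [bernoulliMatrixMeasure_forall_mem hp]; simp
      _ ≤ _ := ENNReal.ofReal_le_ofReal (by simp only [hx, hy, if_true]; simp; positivity)
  by_cases hy : M₀ y.1 y.2 = true
  · calc _ = bernoulliMatrixMeasure ι κ p {M | ∀ z ∈ ({x} : Finset (ι × κ)), M z.1 z.2 = true} := by
          simp [hx, hy]
      _ = ENNReal.ofReal (p ^ 1) := by rw [bernoulliMatrixMeasure_forall_mem hp]; simp
      _ ≤ _ := ENNReal.ofReal_le_ofReal (by simp only [hx, hy, if_true]; simp; positivity)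
  · calc _ = bernoulliMatrixMeasure ι κ p
            {M | ∀ z ∈ ({x, y} : Finset (ι × κ)), M z.1 z.2 = true} := by
          simp [hx, hy]
      _ = ENNReal.ofReal (p ^ 2) := by
          rw [bernoulliMatrixMeasure_forall_mem hp, Finset.card_pair hxy]
      _ ≤ _ := by simp [hx, hy]

theorem bernoulliMatrixMeasure_exists_sprinkle_pair_le {σ : Type*} [Fintype σ] {p : ℝ}
    (hp : 0 ≤ p ∧ p ≤ 1) (M₀ : ι → κ → Bool) (x y : σ → ι × κ) (hxy : ∀ s, x s ≠ y s)
    (K : Set σ)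
    (hM₀ : ∀ s ∈ K, ¬ (M₀ (x s).1 (x s).2 = true ∧ M₀ (y s).1 (y s).2 = true)) :
    bernoulliMatrixMeasure ι κ p {M | ∃ s ∈ K, (M₀ (x s).1 (x s).2 || M (x s).1 (x s).2) = true ∧
        (M₀ (y s).1 (y s).2 || M (y s).1 (y s).2) = true} ≤
      ENNReal.ofReal (Fintype.card σ * p ^ 2 +
        #{s | M₀ (x s).1 (x s).2 = true} * p + #{s | M₀ (y s).1 (y s).2 = true} * p) := by
  classical
  have hp' := hp.1
  calc _ ≤ bernoulliMatrixMeasure ι κ p (⋃ s ∈ ({s | s ∈ K} : Finset σ),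
          {M | (M₀ (x s).1 (x s).2 || M (x s).1 (x s).2) = true ∧
            (M₀ (y s).1 (y s).2 || M (y s).1 (y s).2) = true}) := by
        refine measure_mono ?_
        rintro M ⟨s, hs, h⟩
        simp only [Set.mem_iUnion]
        exact ⟨s, by simpa using hs, h⟩
    _ ≤ _ := measure_biUnion_finset_le _ _
    _ ≤ ∑ s ∈ ({s | s ∈ K} : Finset σ), ENNReal.ofReal
          (p ^ 2 + (if M₀ (x s).1 (x s).2 = true then p else 0) +
            (if M₀ (y s).1 (y s).2 = true then p else 0)) :=
        Finset.sum_le_sum fun s hs =>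
          bernoulliMatrixMeasure_sprinkle_pair_le hp M₀ (hxy s) (hM₀ s (by simpa using hs))
    _ ≤ ∑ s, ENNReal.ofReal (p ^ 2 + (if M₀ (x s).1 (x s).2 = true then p else 0) +
            (if M₀ (y s).1 (y s).2 = true then p else 0)) :=
        Finset.sum_le_sum_of_subset (Finset.subset_univ _)
    _ = _ := by
        rw [← ENNReal.ofReal_sum_of_nonneg fun s _ => by positivity]
        simp [Finset.sum_add_distrib, ← Finset.sum_filter]

end Matrix

theorem zmod_two_eq_or (k : ZMod 2) : k = 0 ∨ k = 1 := by
  revert k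
  decide

/-- A stable 4-cycle of a digraph can only be destabilised, when arcs are added, by a vertex
outside it that becomes adjacent to both of the relevant vertices of the cycle. -/
theorem exists_of_not_isStableCycle_sup {n : ℕ} {A₀ B₀ A B : Fin n → Fin n → Bool}
    {r c : ZMod 2 → Fin n} (hstable : IsStableCycle 2 n A₀ B₀ r c)
    (h : ¬ IsStableCycle 2 n (fun i j => A₀ i j || A i j) (fun i j => B₀ i j || B i j) r c) :
    (∃ i ∈ (Set.range r)ᶜ, (A₀ i (c 0) || A i (c 0)) = true ∧ (A₀ i (c 1) || A i (c 1)) = true) ∨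
      ∃ j ∈ (Set.range c)ᶜ,
        (B₀ (r 0) j || B (r 0) j) = true ∧ (B₀ (r 1) j || B (r 1) j) = true := by
  by_contra! hcon
  obtain ⟨hA, hB⟩ := hcon
  obtain ⟨⟨hr, hc, hBc, hAc⟩, -, -⟩ := hstable
  refine h ⟨⟨hr, hc, fun k => by simp [hBc k], fun k => by simp [hAc k]⟩, ?_, ?_⟩
  · intro i hi k k' hk hk'
    have := hA i hi
    rcases zmod_two_eq_or k with rfl | rfl <;> rcases zmod_two_eq_or k' with rfl | rfl <;>
      first | rfl | exact absurd hk' (this hk) | exact absurd hk (this hk')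
  · intro j hj k k' hk hk'
    have := hB j hj
    rcases zmod_two_eq_or k with rfl | rfl <;> rcases zmod_two_eq_or k' with rfl | rfl <;>
      first | rfl | exact absurd hk' (this hk) | exact absurd hk (this hk')

theorem sprinkling_preserves_stability (n : ℕ) (p₀ p₁ δ : ℝ)
    (hp₀ : 0 ≤ p₀ ∧ p₀ ≤ 1) (hp₁ : 0 ≤ p₁ ∧ p₁ ≤ 1) (hδ : 0 ≤ δ)
    (A₀ B₀ : Fin n → Fin n → Bool) (r c : ZMod 2 → Fin n)
    (hstable : IsStableCycle 2 n A₀ B₀ r c)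
    (hdegR : ∀ k : ZMod 2,
      (((Finset.univ.filter fun j => B₀ (r k) j = true).card : ℝ)) < (1 + δ) * n * p₀)
    (hdegC : ∀ k : ZMod 2,
      (((Finset.univ.filter fun i => A₀ i (c k) = true).card : ℝ)) < (1 + δ) * n * p₀) :
    gameMeasure n p₁
        {ω | ¬ IsStableCycle 2 n (fun i j => A₀ i j || ω.1 i j)
          (fun i j => B₀ i j || ω.2 i j) r c}
      ≤ ENNReal.ofReal (2 * n * p₁ ^ 2 + 4 * (1 + δ) * n * p₀ * p₁) := by
  have := isProbabilityMeasure_bernoulliMeasure hp₁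
  have : IsProbabilityMeasure (bernoulliMatrixMeasure (Fin n) (Fin n) p₁) := by
    unfold bernoulliMatrixMeasure
    infer_instance
  have hr : r 0 ≠ r 1 := hstable.1.1.ne (by decide)
  have hc : c 0 ≠ c 1 := hstable.1.2.1.ne (by decide)
  have hA := bernoulliMatrixMeasure_exists_sprinkle_pair_le hp₁ A₀ (fun i => (i, c 0))
    (fun i => (i, c 1)) (fun i h => hc (congrArg Prod.snd h)) (Set.range r)ᶜ
    (fun i hi h => hc (hstable.2.1 i hi 0 1 h.1 h.2))
  have hB := bernoulliMatrixMeasure_exists_sprinkle_pair_le hp₁ B₀ (fun j => (r 0, j))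
    (fun j => (r 1, j)) (fun j h => hr (congrArg Prod.fst h)) (Set.range c)ᶜ
    (fun j hj h => hr (hstable.2.2 j hj 0 1 h.1 h.2))
  simp only [Fintype.card_fin] at hA hB
  have hp := hp₁.1
  rw [gameMeasure_eq_prod n hp₁]
  set μ := bernoulliMatrixMeasure (Fin n) (Fin n) p₁
  set badA := {M : Fin n → Fin n → Bool | ∃ i ∈ (Set.range r)ᶜ,
    (A₀ i (c 0) || M i (c 0)) = true ∧ (A₀ i (c 1) || M i (c 1)) = true}
  set badB := {M : Fin n → Fin n → Bool | ∃ j ∈ (Set.range c)ᶜ,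
    (B₀ (r 0) j || M (r 0) j) = true ∧ (B₀ (r 1) j || M (r 1) j) = true}
  calc _ ≤ μ.prod μ (badA ×ˢ Set.univ ∪ Set.univ ×ˢ badB) := by
        refine measure_mono fun ω hω => ?_
        rcases exists_of_not_isStableCycle_sup hstable hω with h | h
        · exact Or.inl ⟨h, trivial⟩
        · exact Or.inr ⟨trivial, h⟩
    _ ≤ μ badA + μ badB := by
        refine (measure_union_le _ _).trans ?_
        simp [Measure.prod_prod]
    _ ≤ _ := add_le_add hA hB
    _ ≤ _ := by
        rw [← ENNReal.ofReal_add (by positivity) (by positivity)]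
        refine ENNReal.ofReal_le_ofReal ?_
        linarith [mul_le_mul_of_nonneg_right (hdegC 0).le hp,
          mul_le_mul_of_nonneg_right (hdegC 1).le hp,
          mul_le_mul_of_nonneg_right (hdegR 0).le hp,
          mul_le_mul_of_nonneg_right (hdegR 1).le hp]
end

section
/- Let p : ℕ → [0,1] satisfy e^{−4/3} n^{−2/3} ≤ p(n) ≤ 2⁹ n^{−2/3} for all large n. Then 2.598^n · P_{n,p(n)}(D(A,B) contains no stable 4-cycle) → 0 as n → ∞. -/
open MeasureTheory Filter Finset
open scoped ENNReal

section Bernoulli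

open scoped Classical

variable {ι : Type*} [Fintype ι]

/-- The weight of a configuration under the product Bernoulli(`p`) measure. -/
noncomputable def bernWeight (p : ℝ) (ω : ι → Bool) : ℝ :=
  ∏ c, if ω c then p else 1 - p

/-- Expectation under the product Bernoulli(`p`) measure. -/
noncomputable def bernExp (p : ℝ) (F : (ι → Bool) → ℝ) : ℝ :=
  ∑ ω, bernWeight p ω * F ω

/-- Probability under the product Bernoulli(`p`) measure. -/
noncomputable def bernProb (p : ℝ) (S : Set (ι → Bool)) : ℝ :=
  bernExp p (S.indicator 1)

lemma bernWeight_nonneg {p : ℝ} (h0 : 0 ≤ p) (h1 : p ≤ 1) (ω : ι → Bool) :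
    0 ≤ bernWeight p ω :=
  Finset.prod_nonneg fun c _ => by split_ifs <;> linarith

lemma bernExp_mono {p : ℝ} (h0 : 0 ≤ p) (h1 : p ≤ 1) {F G : (ι → Bool) → ℝ}
    (h : ∀ ω, F ω ≤ G ω) : bernExp p F ≤ bernExp p G :=
  Finset.sum_le_sum fun ω _ => mul_le_mul_of_nonneg_left (h ω) (bernWeight_nonneg h0 h1 ω)

lemma bernExp_sum {p : ℝ} {α : Type*} (s : Finset α) (F : α → (ι → Bool) → ℝ) :
    bernExp p (fun ω => ∑ a ∈ s, F a ω) = ∑ a ∈ s, bernExp p (F a) := by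
  simp only [bernExp, Finset.mul_sum]
  exact Finset.sum_comm

lemma bernExp_add {p : ℝ} (F G : (ι → Bool) → ℝ) :
    bernExp p (fun ω => F ω + G ω) = bernExp p F + bernExp p G := by
  simp only [bernExp, mul_add, Finset.sum_add_distrib]

lemma bernExp_const_mul {p : ℝ} (a : ℝ) (F : (ι → Bool) → ℝ) :
    bernExp p (fun ω => a * F ω) = a * bernExp p F := by
  simp only [bernExp, Finset.mul_sum]
  exact Finset.sum_congr rfl fun ω _ => by ring

lemma bernExp_prod (p : ℝ) (s : Finset ι) :
    bernExp p (fun ω => ∏ c ∈ s, if ω c then (1 : ℝ) else 0) = p ^ s.card := by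
  have h : ∀ ω : ι → Bool, bernWeight p ω * (∏ c ∈ s, if ω c then (1 : ℝ) else 0)
      = ∏ c, ((if ω c then p else 1 - p) * if c ∈ s then (if ω c then (1 : ℝ) else 0) else 1) := by
    intro ω
    rw [Finset.prod_mul_distrib, bernWeight, Finset.prod_ite_mem, Finset.univ_inter]
  simp only [bernExp, h]
  rw [← Fintype.prod_sum (fun c (b : Bool) =>
    (if b then p else 1 - p) * if c ∈ s then (if b then (1 : ℝ) else 0) else 1)]
  have h2 : ∀ c, (∑ b : Bool, (if b then p else 1 - p) *
      if c ∈ s then (if b then (1 : ℝ) else 0) else 1) = if c ∈ s then p else 1 := by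
    intro c
    by_cases hc : c ∈ s <;> simp [hc]
  simp only [h2]
  rw [Finset.prod_ite_mem, Finset.univ_inter, Finset.prod_const]

lemma bernExp_one (p : ℝ) : bernExp p (fun _ : ι → Bool => (1 : ℝ)) = 1 := by
  simpa using bernExp_prod (ι := ι) p ∅

lemma bernExp_coord (p : ℝ) (c : ι) :
    bernExp p (fun ω => if ω c then (1 : ℝ) else 0) = p := by
  simpa using bernExp_prod p {c}

lemma bernExp_coord_mul (p : ℝ) {c c' : ι} (h : c ≠ c') :
    bernExp p (fun ω => (if ω c then (1 : ℝ) else 0) * if ω c' then (1 : ℝ) else 0) = p ^ 2 := by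
  have := bernExp_prod p {c, c'}
  rw [Finset.card_pair h] at this
  simpa only [Finset.prod_pair h] using this

lemma bernProb_mono {p : ℝ} (h0 : 0 ≤ p) (h1 : p ≤ 1) {S T : Set (ι → Bool)} (h : S ⊆ T) :
    bernProb p S ≤ bernProb p T :=
  bernExp_mono h0 h1 fun ω => Set.indicator_le_indicator_of_subset h (fun _ => zero_le_one) ω

lemma bernProb_le_exp {p : ℝ} (h0 : 0 ≤ p) (h1 : p ≤ 1) {S : Set (ι → Bool)}
    {F : (ι → Bool) → ℝ} (hF : ∀ ω, 0 ≤ F ω) (hS : ∀ ω ∈ S, 1 ≤ F ω) :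
    bernProb p S ≤ bernExp p F :=
  bernExp_mono h0 h1 fun ω => by
    by_cases h : ω ∈ S
    · simpa [h] using hS ω h
    · simpa [h] using hF ω

lemma bernProb_biUnion_le {p : ℝ} (h0 : 0 ≤ p) (h1 : p ≤ 1) {α : Type*} (s : Finset α)
    {S : Set (ι → Bool)} (T : α → Set (ι → Bool)) (h : ∀ ω ∈ S, ∃ a ∈ s, ω ∈ T a) :
    bernProb p S ≤ ∑ a ∈ s, bernProb p (T a) := by
  have : bernProb p S ≤ bernExp p (fun ω => ∑ a ∈ s, (T a).indicator 1 ω) := by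
    refine bernProb_le_exp h0 h1
      (fun ω => Finset.sum_nonneg fun a _ => Set.indicator_nonneg (fun _ _ => zero_le_one) ω) ?_
    intro ω hω
    obtain ⟨a, ha, haT⟩ := h ω hω
    calc (1 : ℝ) = (T a).indicator 1 ω := by simp [haT]
      _ ≤ _ := Finset.single_le_sum (f := fun a => (T a).indicator (1 : (ι → Bool) → ℝ) ω)
        (fun a _ => Set.indicator_nonneg (fun _ _ => zero_le_one) ω) ha
  rwa [bernExp_sum] at this

lemma bernProb_union_le {p : ℝ} (h0 : 0 ≤ p) (h1 : p ≤ 1) {S T : Set (ι → Bool)}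
    {a b : ℝ} (hS : bernProb p S ≤ a) (hT : bernProb p T ≤ b) : bernProb p (S ∪ T) ≤ a + b := by
  have := bernProb_biUnion_le h0 h1 (S := S ∪ T) (Finset.univ : Finset Bool)
    (fun b => if b then S else T) (by
      rintro ω (h | h)
      · exact ⟨true, by simp, by simpa using h⟩
      · exact ⟨false, by simp, by simpa using h⟩)
  simp only [Fintype.univ_bool, Finset.mem_singleton, Bool.true_eq_false, not_false_eq_true,
    Finset.sum_insert, Finset.sum_singleton, if_true, Bool.false_eq_true, if_false] at this
  linarith

/-- Resampling a block of coordinates does not change an expectation. -/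
lemma bernExp_resample (p : ℝ) (C : Finset ι) (F : (ι → Bool) → ℝ) :
    bernExp p (fun ω => bernExp p fun x => F (C.piecewise x ω)) = bernExp p F := by
  let e : (ι → Bool) × (ι → Bool) ≃ (ι → Bool) × (ι → Bool) :=
    { toFun := fun z => (C.piecewise z.2 z.1, C.piecewise z.1 z.2)
      invFun := fun z => (C.piecewise z.2 z.1, C.piecewise z.1 z.2)
      left_inv := fun z => by
        ext c <;> by_cases h : c ∈ C <;> simp [h]
      right_inv := fun z => by
        ext c <;> by_cases h : c ∈ C <;> simp [h] }
  have hw : ∀ z, bernWeight p (e z).1 * bernWeight p (e z).2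
      = bernWeight p z.1 * bernWeight p z.2 := by
    intro z
    simp only [bernWeight, ← Finset.prod_mul_distrib]
    refine Finset.prod_congr rfl fun c _ => ?_
    by_cases h : c ∈ C
    · simp [e, h, mul_comm]
    · simp [e, h]
  calc bernExp p (fun ω => bernExp p fun x => F (C.piecewise x ω))
      = ∑ z : (ι → Bool) × (ι → Bool), bernWeight p z.1 * bernWeight p z.2 * F (e z).1 := by
        rw [Fintype.sum_prod_type]
        simp only [bernExp, Finset.mul_sum, mul_assoc, e, Equiv.coe_fn_mk]
    _ = ∑ z : (ι → Bool) × (ι → Bool), bernWeight p (e z).1 * bernWeight p (e z).2 * F (e z).1 := by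
        simp only [hw]
    _ = ∑ z : (ι → Bool) × (ι → Bool), bernWeight p z.1 * bernWeight p z.2 * F z.1 :=
        Equiv.sum_comp e fun z => bernWeight p z.1 * bernWeight p z.2 * F z.1
    _ = bernExp p F := by
        rw [Fintype.sum_prod_type]
        refine Finset.sum_congr rfl fun ω _ => ?_
        have h1 := bernExp_one (ι := ι) p
        simp only [bernExp, mul_one] at h1
        calc _ = (∑ x : ι → Bool, bernWeight p x) * (bernWeight p ω * F ω) := by
              rw [Finset.sum_mul]
              exact Finset.sum_congr rfl fun x _ => by ring
          _ = _ := by rw [h1, one_mul]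

/-- Events that live on separate blocks of coordinates, given the rest, and are conditionally
unlikely: their joint probability is bounded by the product. -/
lemma bernProb_forall_le {p η : ℝ} (h0 : 0 ≤ p) (h1 : p ≤ 1) (hη : 0 ≤ η) {τ : Type*}
    (C : τ → Finset ι) (E : τ → Set (ι → Bool)) (T : Finset τ)
    (hind : ∀ t ∈ T, ∀ t' ∈ T, t ≠ t' → ∀ x ω, (C t').piecewise x ω ∈ E t ↔ ω ∈ E t)
    (hprob : ∀ t ∈ T, ∀ ω, bernProb p {x | (C t).piecewise x ω ∈ E t} ≤ η)
    (S : Finset τ) (hS : S ⊆ T) :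
    bernProb p {ω | ∀ t ∈ S, ω ∈ E t} ≤ η ^ S.card := by
  induction S using Finset.induction_on with
  | empty =>
    refine (bernProb_le_exp h0 h1 (F := fun _ => 1) (fun _ => zero_le_one)
      (fun _ _ => le_rfl)).trans ?_
    simp [bernExp_one]
  | insert t S ht ih =>
    have htT : t ∈ T := hS (Finset.mem_insert_self t S)
    have hST : S ⊆ T := (Finset.subset_insert t S).trans hS
    rw [bernProb, ← bernExp_resample p (C t), Finset.card_insert_of_notMem ht, pow_succ']
    refine le_trans ?_ (mul_le_mul_of_nonneg_left (ih hST) hη)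
    rw [bernProb, ← bernExp_const_mul]
    refine bernExp_mono h0 h1 fun ω => ?_
    by_cases hω : ∀ s ∈ S, ω ∈ E s
    · have : ({ω | ∀ t ∈ S, ω ∈ E t}.indicator (1 : (ι → Bool) → ℝ) ω) = 1 :=
        Set.indicator_of_mem (s := {ω | ∀ t ∈ S, ω ∈ E t}) hω _
      rw [this, mul_one]
      refine le_trans (bernExp_mono h0 h1 fun x => ?_) (hprob t htT ω)
      by_cases hx : (C t).piecewise x ω ∈ E t
      · have h2 : x ∈ {x | (C t).piecewise x ω ∈ E t} := hx
        rw [Set.indicator_of_mem h2]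
        exact Set.indicator_le_self' (fun _ _ => zero_le_one) _
      · rw [Set.indicator_of_notMem]
        · exact Set.indicator_nonneg (fun _ _ => zero_le_one) _
        · exact fun h => hx (h t (Finset.mem_insert_self t S))
    · have h2 : ω ∉ {ω | ∀ t ∈ S, ω ∈ E t} := hω
      rw [Set.indicator_of_notMem h2, mul_zero]
      refine le_of_eq ?_
      refine Finset.sum_eq_zero fun x _ => ?_
      dsimp only
      rw [Set.indicator_of_notMem, mul_zero]
      intro h
      apply hω
      intro s hs
      refine (hind s (hST hs) t htT (fun hst => ht (hst ▸ hs)) x ω).1 ?_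
      exact h s (Finset.mem_insert_of_mem hs)

/-- Among `n` conditionally independent trials with failure probability at most `θ ^ 32`, the
probability that at least `n / 32` fail is at most `(2θ) ^ n`. -/
lemma bernProb_many_le {p θ : ℝ} (h0 : 0 ≤ p) (h1 : p ≤ 1) (hθ : 0 ≤ θ) (hθ1 : θ ≤ 1) {n : ℕ}
    (C : Fin n → Finset ι) (E : Fin n → Set (ι → Bool)) (T : Finset (Fin n))
    (hind : ∀ t ∈ T, ∀ t' ∈ T, t ≠ t' → ∀ x ω, (C t').piecewise x ω ∈ E t ↔ ω ∈ E t)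
    (hprob : ∀ t ∈ T, ∀ ω, bernProb p {x | (C t).piecewise x ω ∈ E t} ≤ θ ^ 32) :
    bernProb p {ω | n ≤ 32 * (T.filter fun t => ω ∈ E t).card} ≤ (2 * θ) ^ n := by
  have key := bernProb_biUnion_le h0 h1 (S := {ω | n ≤ 32 * (T.filter fun t => ω ∈ E t).card})
    (T.powerset.filter fun S => n ≤ 32 * S.card) (fun S => {ω | ∀ t ∈ S, ω ∈ E t}) (by
      intro ω hω
      refine ⟨T.filter fun t => ω ∈ E t, ?_, ?_⟩
      · simp only [Finset.mem_filter, Finset.mem_powerset]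
        exact ⟨Finset.filter_subset _ _, hω⟩
      · intro t ht
        exact (Finset.mem_filter.1 ht).2)
  refine key.trans ?_
  calc _ ≤ ∑ S ∈ T.powerset.filter fun S => n ≤ 32 * S.card, θ ^ n := by
        refine Finset.sum_le_sum fun S hS => ?_
        simp only [Finset.mem_filter, Finset.mem_powerset] at hS
        refine (bernProb_forall_le h0 h1 (pow_nonneg hθ 32) C E T hind hprob S hS.1).trans ?_
        rw [← pow_mul]
        exact pow_le_pow_of_le_one hθ hθ1 hS.2
    _ = ((T.powerset.filter fun S => n ≤ 32 * S.card).card : ℝ) * θ ^ n := by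
        rw [Finset.sum_const, nsmul_eq_mul]
    _ ≤ 2 ^ n * θ ^ n := by
        refine mul_le_mul_of_nonneg_right ?_ (pow_nonneg hθ n)
        have h2 : (T.powerset.filter fun S => n ≤ 32 * S.card).card ≤ 2 ^ n := by
          refine (Finset.card_filter_le _ _).trans ?_
          rw [Finset.card_powerset]
          exact Nat.pow_le_pow_right (by norm_num) (by simpa using Finset.card_le_univ T)
        exact_mod_cast h2
    _ = (2 * θ) ^ n := (mul_pow _ _ _).symm

lemma bernProb_card_gt_le {p d : ℝ} (h0 : 0 ≤ p) (h1 : p ≤ 1) (hd : 0 < d) (S : Finset ι) :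
    bernProb p {x | d < ((S.filter fun c => x c = true).card : ℝ)} ≤ p * S.card / d := by
  have h := bernProb_le_exp h0 h1 (S := {x | d < ((S.filter fun c => x c = true).card : ℝ)})
    (F := fun x => d⁻¹ * ∑ c ∈ S, if x c then (1 : ℝ) else 0)
    (fun x => mul_nonneg (inv_nonneg.2 hd.le)
      (Finset.sum_nonneg fun c _ => by split_ifs <;> norm_num))
    (by
      intro x hx
      simp only [Set.mem_ofPred_eq] at hx
      rw [Finset.sum_boole, inv_mul_eq_div, one_le_div hd]
      exact hx.le)
  rw [bernExp_const_mul, bernExp_sum] at h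
  simp only [bernExp_coord, Finset.sum_const, nsmul_eq_mul] at h
  refine h.trans (le_of_eq ?_)
  field_simp

/-- A lower-tail bound for the number of incidences `a` whose coordinate `g a` is set while no
coordinate of `Q a` is set. -/
lemma bernProb_unspoiled_lt_le {p D q : ℝ} (h0 : 0 < p) (h1 : p ≤ 1) {α : Type*}
    (P : Finset α) (hP : P.Nonempty) (g : α → ι) (Q : α → Finset ι)
    (hgQ : ∀ a ∈ P, g a ∉ Q a) (hQ : ∀ a ∈ P, ((Q a).card : ℝ) ≤ q)
    (hD : ∀ a ∈ P, ((P.filter fun b => g a = g b).card : ℝ) ≤ D) :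
    bernProb p {x | ((P.filter fun a => x (g a) = true ∧ ∀ c ∈ Q a, x c = false).card : ℝ)
      < p * P.card / 4} ≤ 4 * D / (p * P.card) + 4 * p * q := by
  set W : ℝ := (P.card : ℝ) with hW
  have hWpos : 0 < W := by
    rw [hW]
    exact_mod_cast hP.card_pos
  have hpW : 0 < p * W := mul_pos h0 hWpos
  let X : ι → (ι → Bool) → ℝ := fun c x => if x c then 1 else 0
  have hX0 : ∀ c x, 0 ≤ X c x := fun c x => by
    simp only [X]; split_ifs <;> norm_num
  let Y : (ι → Bool) → ℝ := fun x => ∑ a ∈ P, X (g a) x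
  let S : (ι → Bool) → ℝ := fun x => ∑ a ∈ P, ∑ c ∈ Q a, X (g a) x * X c x
  have hS0 : ∀ x, 0 ≤ S x := fun x =>
    Finset.sum_nonneg fun a _ => Finset.sum_nonneg fun c _ => mul_nonneg (hX0 _ _) (hX0 _ _)
  have hcount : ∀ x, Y x - S x ≤
      ((P.filter fun a => x (g a) = true ∧ ∀ c ∈ Q a, x c = false).card : ℝ) := by
    intro x
    rw [← Finset.sum_boole, ← Finset.sum_sub_distrib]
    refine Finset.sum_le_sum fun a _ => ?_
    have hs0 : 0 ≤ ∑ c ∈ Q a, X (g a) x * X c x :=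
      Finset.sum_nonneg fun c _ => mul_nonneg (hX0 _ _) (hX0 _ _)
    by_cases hg : x (g a) = true
    · by_cases hq : ∀ c ∈ Q a, x c = false
      · rw [if_pos ⟨hg, hq⟩]
        have : X (g a) x = 1 := by simp [X, hg]
        linarith
      · rw [if_neg fun h => hq h.2]
        push Not at hq
        obtain ⟨c, hc, hxc⟩ := hq
        have h3 : X (g a) x * X c x ≤ ∑ c ∈ Q a, X (g a) x * X c x :=
          Finset.single_le_sum (f := fun c => X (g a) x * X c x)
            (fun c _ => mul_nonneg (hX0 _ _) (hX0 _ _)) hc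
        have h4 : X c x = 1 := by simp [X, hxc]
        rw [h4, mul_one] at h3
        linarith
    · rw [if_neg fun h => hg h.1]
      have : X (g a) x = 0 := by simp [X, hg]
      linarith
  have hES : bernExp p S ≤ W * q * p ^ 2 := by
    simp only [S, bernExp_sum]
    have : ∀ a ∈ P, ∑ c ∈ Q a, bernExp p (fun x => X (g a) x * X c x) ≤ q * p ^ 2 := by
      intro a ha
      have h2 : ∀ c ∈ Q a, bernExp p (fun x => X (g a) x * X c x) = p ^ 2 := fun c hc =>
        bernExp_coord_mul p fun h => hgQ a ha (h ▸ hc)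
      rw [Finset.sum_congr rfl h2, Finset.sum_const, nsmul_eq_mul]
      exact mul_le_mul_of_nonneg_right (hQ a ha) (sq_nonneg p)
    refine (Finset.sum_le_sum this).trans (le_of_eq ?_)
    rw [Finset.sum_const, nsmul_eq_mul, hW, mul_assoc]
  have hEV : bernExp p (fun x => (Y x - p * W) ^ 2) ≤ p * W * D := by
    have hexp : ∀ x, (Y x - p * W) ^ 2 =
        (∑ a ∈ P, ∑ b ∈ P, X (g a) x * X (g b) x) +
          ((-2 * (p * W)) * (∑ a ∈ P, X (g a) x) + (p * W) ^ 2 * 1) := by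
      intro x
      rw [← Finset.sum_mul_sum]
      simp only [Y]
      ring
    simp only [hexp]
    rw [bernExp_add, bernExp_add, bernExp_const_mul, bernExp_const_mul, bernExp_one, bernExp_sum,
      bernExp_sum]
    have hm : ∑ a ∈ P, bernExp p (fun x => X (g a) x) = p * W := by
      simp only [X, bernExp_coord, Finset.sum_const, nsmul_eq_mul]
      rw [hW, mul_comm]
    have hv : ∑ a ∈ P, bernExp p (fun x => ∑ b ∈ P, X (g a) x * X (g b) x)
        ≤ W * (D * p + W * p ^ 2) := by
      have : ∀ a ∈ P, bernExp p (fun x => ∑ b ∈ P, X (g a) x * X (g b) x)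
          ≤ D * p + W * p ^ 2 := by
        intro a ha
        rw [bernExp_sum]
        have h2 : ∀ b ∈ P, bernExp p (fun x => X (g a) x * X (g b) x)
            ≤ (if g a = g b then 1 else 0) * p + p ^ 2 := by
          intro b _
          split_ifs with h
          · have h3 : ∀ x, X (g a) x * X (g b) x = if x (g a) then (1 : ℝ) else 0 := by
              intro x
              simp only [X, ← h]
              split_ifs <;> norm_num
            simp only [h3, bernExp_coord]
            nlinarith [sq_nonneg p]
          · simp only [X]
            rw [bernExp_coord_mul p h]
            linarith
        refine (Finset.sum_le_sum h2).trans ?_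
        rw [Finset.sum_add_distrib, ← Finset.sum_mul, Finset.sum_boole, Finset.sum_const,
          nsmul_eq_mul]
        exact add_le_add (mul_le_mul_of_nonneg_right (hD a ha) h0.le) le_rfl
      refine (Finset.sum_le_sum this).trans (le_of_eq ?_)
      rw [Finset.sum_const, nsmul_eq_mul, hW]
    rw [hm]
    nlinarith [hv]
  have hfin := bernProb_le_exp h0.le h1
    (S := {x | ((P.filter fun a => x (g a) = true ∧ ∀ c ∈ Q a, x c = false).card : ℝ)
      < p * W / 4})
    (F := fun x => (4 / (p * W) ^ 2) * (Y x - p * W) ^ 2 + (4 / (p * W)) * S x)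
    (fun x => by have := hS0 x; positivity)
    (by
      intro x hx
      simp only [Set.mem_ofPred_eq] at hx
      have hc := hcount x
      have hs := hS0 x
      by_cases hy : Y x < p * W / 2
      · have h5 : (p * W) ^ 2 / 4 ≤ (Y x - p * W) ^ 2 := by nlinarith
        have h6 : 1 ≤ (4 / (p * W) ^ 2) * (Y x - p * W) ^ 2 := by
          rw [div_mul_eq_mul_div, one_le_div (by positivity)]
          linarith
        have : 0 ≤ (4 / (p * W)) * S x := by positivity
        linarith
      · have h6 : 1 ≤ (4 / (p * W)) * S x := by
          rw [div_mul_eq_mul_div, one_le_div hpW]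
          linarith
        have : 0 ≤ (4 / (p * W) ^ 2) * (Y x - p * W) ^ 2 := by positivity
        linarith)
  rw [bernExp_add, bernExp_const_mul, bernExp_const_mul] at hfin
  refine hfin.trans (add_le_add ?_ ?_)
  · refine (mul_le_mul_of_nonneg_left hEV (by positivity)).trans (le_of_eq ?_)
    field_simp
  · refine (mul_le_mul_of_nonneg_left hES (by positivity)).trans (le_of_eq ?_)
    field_simp

end Bernoulli


section Phases

open scoped Classical

variable {ι : Type*} [Fintype ι] {n : ℕ}

lemma bernProb_card_lt_le {p : ℝ} (h0 : 0 < p) (h1 : p ≤ 1) (κ : Fin n ↪ ι)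
    (C : Finset (Fin n)) (hC : C.Nonempty) :
    bernProb p {x | ((C.filter fun j => x (κ j) = true).card : ℝ) < p * C.card / 4}
      ≤ 4 / (p * C.card) := by
  have h := bernProb_unspoiled_lt_le (D := 1) (q := 0) h0 h1 C hC κ (fun _ => ∅) (by simp)
    (by simp) (by
      intro a ha
      have : C.filter (fun b => κ a = κ b) ⊆ {a} := by
        intro b hb
        simp only [Finset.mem_filter, EmbeddingLike.apply_eq_iff_eq] at hb
        simp [hb.2]
      exact_mod_cast Finset.card_le_card this)
  simpa using h

lemma bernProb_card_hit_lt_le {p d w m : ℝ} (h0 : 0 < p) (h1 : p ≤ 1) (κ : Fin n ↪ ι)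
    (B : Fin n → Fin n → Bool) (R C : Finset (Fin n)) (hd : 0 ≤ d)
    (hR : ∀ i ∈ R, ((C.filter fun j => B i j = true).card : ℝ) ≤ d)
    (hC : ∀ j ∈ C, ((R.filter fun i => B i j = true).card : ℝ) ≤ d)
    (hw : w ≤ (((R ×ˢ C).filter fun z => B z.1 z.2 = true).card : ℝ)) (hw0 : 0 < w)
    (hm : m ≤ p * w / 4) :
    bernProb p {x | ((R.filter fun i => ∃ j ∈ C, B i j = true ∧ x (κ j) = true).card : ℝ) < m}
      ≤ 4 * d / (p * w) + 4 * p * d := by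
  set P := (R ×ˢ C).filter fun z => B z.1 z.2 = true with hPdef
  have hP : P.Nonempty := by
    rw [← Finset.card_pos]
    exact_mod_cast hw0.trans_le hw
  let Q : Fin n × Fin n → Finset ι := fun z =>
    ((C.filter fun j => B z.1 j = true).erase z.2).map κ
  have h := bernProb_unspoiled_lt_le (D := d) (q := d) h0 h1 P hP (fun z => κ z.2) Q
    (by simp [Q])
    (by
      intro z hz
      simp only [hPdef, Finset.mem_filter, Finset.mem_product] at hz
      refine le_trans ?_ (hR z.1 hz.1.1)
      simp only [Q, Finset.card_map]
      exact_mod_cast Finset.card_le_card (Finset.erase_subset _ _))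
    (by
      intro z hz
      simp only [hPdef, Finset.mem_filter, Finset.mem_product] at hz
      refine le_trans ?_ (hC z.2 hz.1.2)
      norm_cast
      refine Finset.card_le_card_of_injOn Prod.fst ?_ ?_
      · intro b hb
        simp only [hPdef, Finset.coe_filter, Finset.mem_filter, Finset.mem_product,
          EmbeddingLike.apply_eq_iff_eq, Set.mem_ofPred_eq] at hb ⊢
        exact ⟨hb.1.1.1, hb.2 ▸ hb.1.2⟩
      · intro b hb b' hb' hbb
        simp only [Finset.coe_filter, EmbeddingLike.apply_eq_iff_eq, Set.mem_ofPred_eq] at hb hb'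
        exact Prod.ext hbb (hb.2.symm.trans hb'.2))
  refine (bernProb_mono h0.le h1 ?_).trans (h.trans ?_)
  · intro x hx
    simp only [Set.mem_ofPred_eq] at hx ⊢
    refine lt_of_le_of_lt ?_ (hx.trans_le (hm.trans ?_))
    · norm_cast
      refine Finset.card_le_card_of_injOn Prod.fst ?_ ?_
      · intro b hb
        simp only [hPdef, Finset.coe_filter, Finset.mem_filter, Finset.mem_product,
          Set.mem_ofPred_eq] at hb ⊢
        exact ⟨hb.1.1.1, b.2, hb.1.1.2, hb.1.2, hb.2.1⟩
      · intro b hb b' hb' hbb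
        simp only [hPdef, Q, Finset.coe_filter, Finset.mem_filter, Finset.mem_product,
          Set.mem_ofPred_eq] at hb hb'
        by_contra hne
        have h2 : b'.2 ≠ b.2 := fun h2 => hne (Prod.ext hbb h2.symm)
        have := hb.2.2 (κ b'.2) (by
          simp only [Finset.mem_map, EmbeddingLike.apply_eq_iff_eq, exists_eq_right,
            Finset.mem_erase, Finset.mem_filter]
          exact ⟨h2, hb'.1.1.2, hbb ▸ hb'.1.2⟩)
        rw [hb'.2.1] at this
        exact absurd this (by simp)
    · gcongr
  · gcongr

lemma bernProb_card_linked_lt_le {p d : ℝ} (h0 : 0 < p) (h1 : p ≤ 1) (κ : Fin n ↪ ι)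
    (B : Fin n → Fin n → Bool) (I R C : Finset (Fin n)) (A : Fin n → C → Bool) (m : ℕ)
    (hI : I.Nonempty) (hm : 0 < m) (hd : 0 ≤ d)
    (hA : ∀ j, ((univ.filter fun i => A i j = true).card : ℝ) ≤ d)
    (hB : ∀ i ∈ R, ((univ.filter fun j => B i j = true).card : ℝ) ≤ d)
    (hM : ∀ i₂ ∈ I, m ≤ (R.filter fun i₁ => ∃ j : C, B i₁ j = true ∧ A i₂ j = true).card) :
    bernProb p {x | ((I.filter fun i₂ => ∃ i₁ ∈ R, ∃ j : C, B i₁ j = true ∧ A i₂ j = true ∧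
        x (κ i₁) = true ∧ ∀ i, A i j = true → x (κ i) = true → i = i₁ ∨ i = i₂).card : ℝ)
        < p * (I.card * m) / 4}
      ≤ 4 * d ^ 2 / (p * (I.card * m)) + 4 * p * (m + d) := by
  have hM' : ∀ i₂, ∃ s : Finset (Fin n), i₂ ∈ I →
      s ⊆ (R.filter fun i₁ => ∃ j : C, B i₁ j = true ∧ A i₂ j = true) ∧ s.card = m := by
    intro i₂
    by_cases h : i₂ ∈ I
    · obtain ⟨s, hs⟩ := Finset.exists_subset_card_eq (hM i₂ h)
      exact ⟨s, fun _ => hs⟩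
    · exact ⟨∅, fun h' => absurd h' h⟩
  choose M hM2 using hM'
  have hwit : ∀ z : Fin n × Fin n, ∃ j : Option C, z.1 ∈ I → z.2 ∈ M z.1 →
      ∃ j', j = some j' ∧ B z.2 j' = true ∧ A z.1 j' = true := by
    intro z
    by_cases h : z.1 ∈ I ∧ z.2 ∈ M z.1
    · have := (hM2 z.1 h.1).1 h.2
      simp only [Finset.mem_filter] at this
      obtain ⟨-, j, hj⟩ := this
      exact ⟨some j, fun _ _ => ⟨j, rfl, hj⟩⟩
    · exact ⟨none, fun h2 h3 => absurd ⟨h2, h3⟩ h⟩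
  choose w hw using hwit
  let P : Finset (Fin n × Fin n) := univ.filter fun z => z.1 ∈ I ∧ z.2 ∈ M z.1
  have hPcard : P.card = I.card * m := by
    have : P = I.biUnion fun i => (M i).image fun i₁ => (i, i₁) := by
      ext ⟨a, b⟩
      simp only [P, Finset.mem_filter, Finset.mem_univ, true_and, Finset.mem_biUnion,
        Finset.mem_image, Prod.mk.injEq]
      constructor
      · rintro ⟨ha, hb⟩
        exact ⟨a, ha, b, hb, rfl, rfl⟩
      · rintro ⟨a, ha, b, hb, rfl, rfl⟩
        exact ⟨ha, hb⟩
    rw [this, Finset.card_biUnion]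
    · rw [Finset.sum_congr rfl (g := fun _ => m), Finset.sum_const, smul_eq_mul]
      intro i hi
      rw [Finset.card_image_of_injective _ (Prod.mk_right_injective i)]
      exact (hM2 i hi).2
    · intro i _ i' _ hii
      rw [Function.onFun, Finset.disjoint_left]
      rintro z hz hz'
      simp only [Finset.mem_image] at hz hz'
      obtain ⟨_, _, rfl⟩ := hz
      obtain ⟨_, _, h⟩ := hz'
      exact hii (congrArg Prod.fst h).symm
  have hP : P.Nonempty := by
    rw [← Finset.card_pos, hPcard]
    exact Nat.mul_pos hI.card_pos hm
  let Q₀ : Fin n × Fin n → Finset (Fin n) := fun z =>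
    (M z.1).erase z.2 ∪ univ.filter fun i => (∃ j, w z = some j ∧ A i j = true) ∧ i ≠ z.2 ∧ i ≠ z.1
  have h := bernProb_unspoiled_lt_le (D := d ^ 2) (q := m + d) h0 h1 P hP (fun z => κ z.2)
    (fun z => (Q₀ z).map κ) (by simp [Q₀])
    (by
      intro z hz
      simp only [P, Finset.mem_filter, Finset.mem_univ, true_and] at hz
      obtain ⟨j, hj, -⟩ := hw z hz.1 hz.2
      rw [Finset.card_map]
      have h2 : ((Q₀ z).card : ℝ) ≤ ((M z.1).card : ℝ)
          + ((univ.filter fun i => A i j = true).card : ℝ) := by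
        norm_cast
        refine (Finset.card_union_le _ _).trans (add_le_add ?_ ?_)
        · exact Finset.card_le_card (Finset.erase_subset _ _)
        · refine Finset.card_le_card fun i hi => ?_
          simp only [Finset.mem_filter, Finset.mem_univ, true_and, hj] at hi ⊢
          obtain ⟨⟨j', hj', hA'⟩, -⟩ := hi
          rwa [Option.some.inj hj']
      refine h2.trans (add_le_add ?_ (hA j))
      rw [(hM2 z.1 hz.1).2])
    (by
      intro z hz
      simp only [P, Finset.mem_filter, Finset.mem_univ, true_and] at hz
      have hzR : z.2 ∈ R := (Finset.mem_filter.1 ((hM2 z.1 hz.1).1 hz.2)).1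
      have h2 : (P.filter fun b => κ z.2 = κ b.2).card ≤
          ((univ.filter fun j : C => B z.2 j = true).biUnion
            fun j => univ.filter fun i => A i j = true).card := by
        refine Finset.card_le_card_of_injOn Prod.fst ?_ ?_
        · intro b hb
          simp only [P, Finset.coe_filter, Finset.mem_filter, Finset.mem_univ, true_and,
            EmbeddingLike.apply_eq_iff_eq, Set.mem_ofPred_eq] at hb
          obtain ⟨j, -, hj1, hj2⟩ := hw b hb.1.1 hb.1.2
          simp only [Finset.coe_biUnion, Set.mem_iUnion, Finset.mem_coe, Finset.mem_filter,
            Finset.mem_univ, true_and]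
          exact ⟨j, hb.2 ▸ hj1, hj2⟩
        · intro b hb b' hb' hbb
          simp only [Finset.coe_filter, EmbeddingLike.apply_eq_iff_eq, Set.mem_ofPred_eq] at hb hb'
          exact Prod.ext hbb (hb.2.symm.trans hb'.2)
      have h3 : ((univ.filter fun j : C => B z.2 j = true).card : ℝ) ≤ d := by
        refine le_trans ?_ (hB z.2 hzR)
        norm_cast
        refine Finset.card_le_card_of_injOn Subtype.val ?_ Subtype.val_injective.injOn
        intro j hj
        simpa using hj
      calc ((P.filter fun b => κ z.2 = κ b.2).card : ℝ)
          ≤ ∑ j ∈ univ.filter fun j : C => B z.2 j = true,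
              ((univ.filter fun i => A i j = true).card : ℝ) := by
            exact_mod_cast h2.trans Finset.card_biUnion_le
        _ ≤ ∑ j ∈ univ.filter fun j : C => B z.2 j = true, d :=
            Finset.sum_le_sum fun j _ => hA j
        _ ≤ d * d := by
            rw [Finset.sum_const, nsmul_eq_mul]
            exact mul_le_mul_of_nonneg_right h3 hd
        _ = d ^ 2 := (sq d).symm)
  rw [hPcard] at h
  push_cast at h
  refine (bernProb_mono h0.le h1 ?_).trans h
  intro x hx
  simp only [Set.mem_ofPred_eq] at hx ⊢
  refine lt_of_le_of_lt ?_ hx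
  norm_cast
  refine Finset.card_le_card_of_injOn Prod.fst ?_ ?_
  · intro z hz
    simp only [P, Finset.coe_filter, Finset.mem_filter, Finset.mem_univ, true_and,
      Set.mem_ofPred_eq] at hz ⊢
    obtain ⟨⟨hz1, hz2⟩, hx1, hx2⟩ := hz
    obtain ⟨j, hj, hj1, hj2⟩ := hw z hz1 hz2
    refine ⟨hz1, z.2, (Finset.mem_filter.1 ((hM2 z.1 hz1).1 hz2)).1, j, hj1, hj2, hx1, ?_⟩
    intro i hi hxi
    by_contra hne
    push Not at hne
    have := hx2 (κ i) (Finset.mem_map_of_mem κ (Finset.mem_union_right _ (by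
      simp only [Finset.mem_filter, Finset.mem_univ, true_and]
      exact ⟨⟨j, hj, hi⟩, hne⟩)))
    rw [hxi] at this
    exact absurd this (by simp)
  · intro z hz z' hz' hzz
    simp only [P, Finset.coe_filter, Finset.mem_filter, Finset.mem_univ, true_and,
      Set.mem_ofPred_eq] at hz hz'
    by_contra hne
    have h2 : z'.2 ≠ z.2 := fun h2 => hne (Prod.ext hzz h2.symm)
    have := hz.2.2 (κ z'.2) (Finset.mem_map_of_mem κ (Finset.mem_union_left _
      (Finset.mem_erase.2 ⟨h2, hzz ▸ hz'.1.2⟩)))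
    rw [hz'.2.1] at this
    exact absurd this (by simp)

lemma bernProb_not_exists_le {p d w : ℝ} (h0 : 0 < p) (h1 : p ≤ 1) (κ : Fin n ↪ ι)
    (T : Finset (Fin n)) (row : Fin n → Fin n → Bool) (e : Fin n → Fin n)
    (hrow : ∀ j ∈ T, ((univ.filter fun k => row j k = true).card : ℝ) ≤ d)
    (hw : w ≤ T.card) (hw0 : 0 < w) :
    bernProb p {x | ¬ ∃ j ∈ T, x (κ j) = true ∧
        ∀ k, row j k = true → x (κ k) = true → k = e j ∨ k = j}
      ≤ 4 / (p * w) + 4 * p * d := by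
  have hT : T.Nonempty := by
    rw [← Finset.card_pos]
    exact_mod_cast hw0.trans_le hw
  let Q₀ : Fin n → Finset (Fin n) := fun j =>
    univ.filter fun k => row j k = true ∧ k ≠ e j ∧ k ≠ j
  have h := bernProb_unspoiled_lt_le (D := 1) (q := d) h0 h1 T hT κ
    (fun j => (Q₀ j).map κ) (by simp [Q₀])
    (by
      intro j hj
      rw [Finset.card_map]
      refine le_trans ?_ (hrow j hj)
      norm_cast
      refine Finset.card_le_card fun k hk => ?_
      simp only [Q₀, Finset.mem_filter, Finset.mem_univ, true_and] at hk ⊢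
      exact hk.1)
    (by
      intro a ha
      have : T.filter (fun b => κ a = κ b) ⊆ {a} := by
        intro b hb
        simp only [Finset.mem_filter, EmbeddingLike.apply_eq_iff_eq] at hb
        simp [hb.2]
      exact_mod_cast Finset.card_le_card this)
  refine (bernProb_mono h0.le h1 ?_).trans (h.trans ?_)
  · intro x hx
    simp only [Set.mem_ofPred_eq] at hx ⊢
    have : (T.filter fun j => x (κ j) = true ∧ ∀ c ∈ (Q₀ j).map κ, x c = false) = ∅ := by
      refine Finset.filter_eq_empty_iff.2 fun j hj hj2 => hx ⟨j, hj, hj2.1, fun k hk hxk => ?_⟩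
      by_contra hne
      push Not at hne
      have := hj2.2 (κ k) (Finset.mem_map_of_mem κ (by
        simp only [Q₀, Finset.mem_filter, Finset.mem_univ, true_and]
        exact ⟨hk, hne⟩))
      rw [hxk] at this
      exact absurd this (by simp)
    rw [this]
    have : (0 : ℝ) < T.card := hw0.trans_le hw
    simp only [Finset.card_empty, Nat.cast_zero]
    positivity
  · rw [mul_one]
    gcongr

end Phases


section Events

open scoped Classical

variable {n : ℕ}

/-- Index set of the entries of a pair of matrices: `(true, i, j)` is the entry `A i j` and
`(false, i, j)` is the entry `B i j`. -/
abbrev GameIdx (n : ℕ) := Bool × Fin n × Fin n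

/-- The positions of row `i` of `A` (`s = true`) or `B` (`s = false`). -/
def rowEmb (s : Bool) (i : Fin n) : Fin n ↪ GameIdx n :=
  ⟨fun j => (s, i, j), fun _ _ h => by simpa using h⟩

/-- The positions of column `j` of `A` (`s = true`) or `B` (`s = false`). -/
def colEmb (s : Bool) (j : Fin n) : Fin n ↪ GameIdx n :=
  ⟨fun i => (s, i, j), fun _ _ h => by simpa using h⟩

lemma rowEmb_apply (s : Bool) (i j : Fin n) : rowEmb s i j = (s, i, j) := rfl

lemma colEmb_apply (s : Bool) (i j : Fin n) : colEmb s j i = (s, i, j) := rfl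

lemma piecewise_row (s s' : Bool) (i i' j : Fin n) (x ω : GameIdx n → Bool)
    [∀ c, Decidable (c ∈ univ.map (rowEmb s i))] :
    (univ.map (rowEmb s i)).piecewise x ω (s', i', j)
      = if s' = s ∧ i' = i then x (s', i', j) else ω (s', i', j) := by
  have h : (s', i', j) ∈ univ.map (rowEmb s i) ↔ s' = s ∧ i' = i := by
    simp only [Finset.mem_map, Finset.mem_univ, true_and, rowEmb_apply, Prod.mk.injEq]
    constructor
    · rintro ⟨a, h1, h2, h3⟩
      exact ⟨h1.symm, h2.symm⟩
    · rintro ⟨h1, h2⟩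
      exact ⟨j, h1.symm, h2.symm, rfl⟩
  simp only [Finset.piecewise, h]

lemma piecewise_col (s s' : Bool) (i j j' : Fin n) (x ω : GameIdx n → Bool)
    [∀ c, Decidable (c ∈ univ.map (colEmb s j))] :
    (univ.map (colEmb s j)).piecewise x ω (s', i, j')
      = if s' = s ∧ j' = j then x (s', i, j') else ω (s', i, j') := by
  have h : (s', i, j') ∈ univ.map (colEmb s j) ↔ s' = s ∧ j' = j := by
    simp only [Finset.mem_map, Finset.mem_univ, true_and, colEmb_apply, Prod.mk.injEq]
    constructor
    · rintro ⟨a, h1, h2, h3⟩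
      exact ⟨h1.symm, h3.symm⟩
    · rintro ⟨h1, h2⟩
      exact ⟨i, h1.symm, rfl, h2.symm⟩
  simp only [Finset.piecewise, h]

lemma bernProb_many_row_le {p θ : ℝ} (h0 : 0 ≤ p) (h1 : p ≤ 1) (hθ : 0 ≤ θ) (hθ1 : θ ≤ 1)
    (s : Bool) (Φ : (Fin n → Bool) → Prop)
    (h : ∀ κ : Fin n ↪ GameIdx n, bernProb p {x | Φ fun j => x (κ j)} ≤ θ ^ 32) :
    bernProb p {ω : GameIdx n → Bool |
      n ≤ 32 * (univ.filter fun i => Φ fun j => ω (s, i, j)).card} ≤ (2 * θ) ^ n := by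
  refine bernProb_many_le h0 h1 hθ hθ1 (fun i => univ.map (rowEmb s i))
    (fun i => {ω | Φ fun j => ω (s, i, j)}) univ ?_ ?_
  · intro i _ i' _ hii x ω
    simp [piecewise_row, hii]
  · intro i _ ω
    simpa [piecewise_row, rowEmb_apply] using h (rowEmb s i)

lemma bernProb_many_col_le {p θ : ℝ} (h0 : 0 ≤ p) (h1 : p ≤ 1) (hθ : 0 ≤ θ) (hθ1 : θ ≤ 1)
    (s : Bool) (Φ : (Fin n → Bool) → Prop)
    (h : ∀ κ : Fin n ↪ GameIdx n, bernProb p {x | Φ fun i => x (κ i)} ≤ θ ^ 32) :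
    bernProb p {ω : GameIdx n → Bool |
      n ≤ 32 * (univ.filter fun j => Φ fun i => ω (s, i, j)).card} ≤ (2 * θ) ^ n := by
  refine bernProb_many_le h0 h1 hθ hθ1 (fun j => univ.map (colEmb s j))
    (fun j => {ω | Φ fun i => ω (s, i, j)}) univ ?_ ?_
  · intro i _ i' _ hii x ω
    simp [piecewise_col, hii]
  · intro i _ ω
    simpa [piecewise_col, colEmb_apply] using h (colEmb s i)

lemma bernProb_card_univ_gt_le {ι : Type*} [Fintype ι] {p d : ℝ} (h0 : 0 ≤ p) (h1 : p ≤ 1)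
    (hd : 0 < d) (κ : Fin n ↪ ι) :
    bernProb p {x | d < ((univ.filter fun j => x (κ j) = true).card : ℝ)} ≤ p * n / d := by
  have h := bernProb_card_gt_le h0 h1 hd (univ.map κ)
  simpa [Finset.filter_map, Function.comp_def] using h

/-- Few hits of row `i` of `A`, through `B`, from a bounded-degree block `R × C` of `B`. -/
def hitFail (d w m : ℝ) (R C : Finset (Fin n)) (i : Fin n) : Set (GameIdx n → Bool) :=
  {ω | (∀ i' ∈ R, ((C.filter fun j => ω (false, i', j) = true).card : ℝ) ≤ d) ∧
    (∀ j ∈ C, ((R.filter fun i' => ω (false, i', j) = true).card : ℝ) ≤ d) ∧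
    w ≤ (((R ×ˢ C).filter fun z => ω (false, z.1, z.2) = true).card : ℝ) ∧
    ((R.filter fun i' => ∃ j ∈ C, ω (false, i', j) = true ∧ ω (true, i, j) = true).card : ℝ) < m}

lemma bernProb_hitFail_le {p d w m θ : ℝ} (h0 : 0 < p) (h1 : p ≤ 1) (hθ : 0 ≤ θ) (hθ1 : θ ≤ 1)
    (hd : 0 ≤ d) (hw0 : 0 < w) (hm : m ≤ p * w / 4)
    (hη : 4 * d / (p * w) + 4 * p * d ≤ θ ^ 32) (R C : Finset (Fin n)) :
    bernProb p {ω : GameIdx n → Bool |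
      n ≤ 32 * (univ.filter fun i => ω ∈ hitFail d w m R C i).card} ≤ (2 * θ) ^ n := by
  refine bernProb_many_le h0.le h1 hθ hθ1 (fun i => univ.map (rowEmb true i))
    (hitFail d w m R C) univ ?_ ?_
  · intro i _ i' _ hii x ω
    simp only [hitFail, Set.mem_ofPred_eq, piecewise_row, hii, Bool.false_eq_true, false_and,
      and_false, if_false]
  · intro i _ ω
    simp only [hitFail, Set.mem_ofPred_eq, piecewise_row, Bool.false_eq_true, false_and, if_false,
      and_self, if_true]
    by_cases hc : (∀ i' ∈ R, ((C.filter fun j => ω (false, i', j) = true).card : ℝ) ≤ d) ∧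
      (∀ j ∈ C, ((R.filter fun i' => ω (false, i', j) = true).card : ℝ) ≤ d) ∧
      w ≤ (((R ×ˢ C).filter fun z => ω (false, z.1, z.2) = true).card : ℝ)
    · refine le_trans (bernProb_mono h0.le h1 fun x hx => hx.2.2.2) (le_trans ?_ hη)
      exact bernProb_card_hit_lt_le h0 h1 (rowEmb true i) (fun i j => ω (false, i, j)) R C hd
        hc.1 hc.2.1 hc.2.2 hw0 hm
    · refine le_trans (bernProb_mono (T := ∅) h0.le h1 fun x hx => ?_) ?_
      · exact hc ⟨hx.1, hx.2.1, hx.2.2.1⟩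
      · simp only [bernProb, bernExp, Set.indicator_empty, mul_zero, Finset.sum_const_zero]
        positivity

/-- A directed path `c_{j₂} → r_{i₁} → c_{j₁} → r_{i₂}` such that no further row has both columns
as in-neighbours. -/
def IsLink (ω : GameIdx n → Bool) (i₁ i₂ j₁ j₂ : Fin n) : Prop :=
  ω (false, i₁, j₁) = true ∧ ω (true, i₂, j₁) = true ∧ ω (true, i₁, j₂) = true ∧
    ∀ i, ω (true, i, j₁) = true → ω (true, i, j₂) = true → i = i₁ ∨ i = i₂

/-- Few links from column `j₂` to `I` through a bounded-degree block, although all vertices of `I`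
can be reached from many rows. -/
def linkFail (p d : ℝ) (m : ℕ) (I R C : Finset (Fin n)) (j₂ : Fin n) : Set (GameIdx n → Bool) :=
  {ω | (∀ j : C, ((univ.filter fun i => ω (true, i, (j : Fin n)) = true).card : ℝ) ≤ d) ∧
    (∀ i ∈ R, ((univ.filter fun j => ω (false, i, j) = true).card : ℝ) ≤ d) ∧
    (∀ i₂ ∈ I, m ≤ (R.filter fun i₁ => ∃ j : C, ω (false, i₁, (j : Fin n)) = true ∧
      ω (true, i₂, (j : Fin n)) = true).card) ∧
    ((I.filter fun i₂ => ∃ i₁ ∈ R, ∃ j : C, IsLink ω i₁ i₂ j j₂).card : ℝ)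
      < p * (I.card * m) / 4}

lemma bernProb_linkFail_le {p d θ : ℝ} {m : ℕ} (h0 : 0 < p) (h1 : p ≤ 1) (hθ : 0 ≤ θ)
    (hθ1 : θ ≤ 1) (hd : 0 ≤ d) (hm : 0 < m) (hn : 0 < n)
    (hη : 4 * d ^ 2 / (p * (n / 32 * m)) + 4 * p * (m + d) ≤ θ ^ 32)
    (L I R C : Finset (Fin n)) (hC : C ⊆ L) (hI : n ≤ 32 * I.card) :
    bernProb p {ω : GameIdx n → Bool |
      n ≤ 32 * (Lᶜ.filter fun j => ω ∈ linkFail p d m I R C j).card} ≤ (2 * θ) ^ n := by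
  refine bernProb_many_le h0.le h1 hθ hθ1 (fun j => univ.map (colEmb true j))
    (linkFail p d m I R C) Lᶜ ?_ ?_
  · intro j hj j' hj' hjj x ω
    have hne : ∀ k : C, (k : Fin n) ≠ j' := fun k hk =>
      (Finset.mem_compl.1 hj') (hk ▸ hC k.2)
    have hlink : ∀ [∀ c, Decidable (c ∈ univ.map (colEmb true j'))] (i₁ i₂ : Fin n) (k : C),
        IsLink ((univ.map (colEmb true j')).piecewise x ω) i₁ i₂ k j ↔ IsLink ω i₁ i₂ k j := by
      intro _ i₁ i₂ k
      simp only [IsLink, piecewise_col, hne, hjj, Bool.false_eq_true, and_false, if_false]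
    simp only [linkFail, hlink, Set.mem_ofPred_eq, piecewise_col, hne, Bool.false_eq_true,
      false_and, and_false, if_false]
  · intro j hj ω
    have hne : ∀ k : C, (k : Fin n) ≠ j := fun k hk =>
      (Finset.mem_compl.1 hj) (hk ▸ hC k.2)
    simp only [linkFail, IsLink, Set.mem_ofPred_eq, piecewise_col, hne, Bool.false_eq_true,
      false_and, and_false, if_false, and_self, if_true]
    by_cases hc : (∀ j : C, ((univ.filter fun i => ω (true, i, (j : Fin n)) = true).card : ℝ) ≤ d) ∧
      (∀ i ∈ R, ((univ.filter fun j => ω (false, i, j) = true).card : ℝ) ≤ d) ∧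
      (∀ i₂ ∈ I, m ≤ (R.filter fun i₁ => ∃ j : C, ω (false, i₁, (j : Fin n)) = true ∧
        ω (true, i₂, (j : Fin n)) = true).card)
    · refine le_trans (bernProb_mono h0.le h1 fun x hx => hx.2.2.2) (le_trans ?_ hη)
      have hIne : I.Nonempty := by
        rw [← Finset.card_pos]
        omega
      have hI' : (n : ℝ) / 32 ≤ I.card := by
        rw [div_le_iff₀ (by norm_num), mul_comm]
        exact_mod_cast hI
      have hnR : (0 : ℝ) < n := by exact_mod_cast hn
      have hmR : (0 : ℝ) < m := by exact_mod_cast hm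
      refine (bernProb_card_linked_lt_le h0 h1 (colEmb true j) (fun i j => ω (false, i, j)) I R C
        (fun i j => ω (true, i, (j : Fin n))) m hIne hm hd hc.1 hc.2.1 hc.2.2).trans ?_
      gcongr
    · refine le_trans (bernProb_mono (T := ∅) h0.le h1 fun x hx => ?_) ?_
      · exact hc ⟨hx.1, hx.2.1, hx.2.2.1⟩
      · simp only [bernProb, bernExp, Set.indicator_empty, mul_zero, Finset.sum_const_zero]
        positivity

/-- Row `i₂` of `B` closes no stable 4-cycle although many links end in it. -/
def closeFail (d τ : ℝ) (L R C : Finset (Fin n)) (i₂ : Fin n) : Set (GameIdx n → Bool) :=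
  {ω | (∀ i : R, ((univ.filter fun j => ω (false, (i : Fin n), j) = true).card : ℝ) ≤ d) ∧
    τ ≤ ((Lᶜ.filter fun j₂ => ∃ i₁ : R, ∃ j₁ ∈ C, IsLink ω i₁ i₂ j₁ j₂).card : ℝ) ∧
    ¬ ∃ i₁ : R, ∃ j₁ ∈ C, ∃ j₂ ∈ Lᶜ, IsLink ω i₁ i₂ j₁ j₂ ∧ ω (false, i₂, j₂) = true ∧
      ∀ k, ω (false, (i₁ : Fin n), k) = true → ω (false, i₂, k) = true → k = j₁ ∨ k = j₂}

lemma bernProb_closeFail_le {p d τ θ : ℝ} (h0 : 0 < p) (h1 : p ≤ 1) (hθ : 0 ≤ θ)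
    (hθ1 : θ ≤ 1) (hτ : 0 < τ)
    (hη : 4 / (p * τ) + 4 * p * d ≤ θ ^ 32) (L R C : Finset (Fin n)) (hR : R ⊆ L) :
    bernProb p {ω : GameIdx n → Bool |
      n ≤ 32 * (Lᶜ.filter fun i => ω ∈ closeFail d τ L R C i).card} ≤ (2 * θ) ^ n := by
  refine bernProb_many_le h0.le h1 hθ hθ1 (fun i => univ.map (rowEmb false i))
    (closeFail d τ L R C) Lᶜ ?_ ?_
  · intro i hi i' hi' hii x ω
    have hne : ∀ k : R, (k : Fin n) ≠ i' := fun k hk =>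
      (Finset.mem_compl.1 hi') (hk ▸ hR k.2)
    have hlink : ∀ [∀ c, Decidable (c ∈ univ.map (rowEmb false i'))] (i₁ : R) (j₁ j₂ : Fin n),
        IsLink ((univ.map (rowEmb false i')).piecewise x ω) i₁ i j₁ j₂ ↔ IsLink ω i₁ i j₁ j₂ := by
      intro _ i₁ j₁ j₂
      simp only [IsLink, piecewise_row, hne, Bool.true_eq_false, false_and, and_false, if_false]
    simp only [closeFail, hlink, Set.mem_ofPred_eq, piecewise_row, hne, hii, and_false, if_false]
  · intro i hi ω
    have hne : ∀ k : R, (k : Fin n) ≠ i := fun k hk =>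
      (Finset.mem_compl.1 hi) (hk ▸ hR k.2)
    have hlink : ∀ [∀ c, Decidable (c ∈ univ.map (rowEmb false i))] (x : GameIdx n → Bool)
        (i₁ : R) (j₁ j₂ : Fin n),
        IsLink ((univ.map (rowEmb false i)).piecewise x ω) i₁ i j₁ j₂ ↔ IsLink ω i₁ i j₁ j₂ := by
      intro _ x i₁ j₁ j₂
      simp only [IsLink, piecewise_row, hne, Bool.true_eq_false, false_and, and_false, if_false]
    simp only [closeFail, hlink, Set.mem_ofPred_eq, piecewise_row, hne,
      and_false, if_false, and_self, if_true]
    by_cases hc : (∀ i : R, ((univ.filter fun j => ω (false, (i : Fin n), j) = true).card : ℝ)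
        ≤ d) ∧
      τ ≤ ((Lᶜ.filter fun j₂ => ∃ i₁ : R, ∃ j₁ ∈ C, IsLink ω i₁ i j₁ j₂).card : ℝ)
    · set T := Lᶜ.filter fun j₂ => ∃ i₁ : R, ∃ j₁ ∈ C, IsLink ω i₁ i j₁ j₂
      have hwit : ∀ j₂, ∃ z : Fin n × Fin n, j₂ ∈ T →
          ∃ h : z.1 ∈ R, z.2 ∈ C ∧ IsLink ω z.1 i z.2 j₂ := by
        intro j₂
        by_cases h : j₂ ∈ T
        · obtain ⟨-, i₁, j₁, hj₁, hl⟩ := Finset.mem_filter.1 h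
          exact ⟨(i₁, j₁), fun _ => ⟨i₁.2, hj₁, hl⟩⟩
        · exact ⟨(j₂, j₂), fun h' => absurd h' h⟩
      choose z hz using hwit
      refine le_trans (bernProb_mono h0.le h1 fun x hx => ?_) (le_trans
        (bernProb_not_exists_le h0 h1 (rowEmb false i) T (fun j k => ω (false, (z j).1, k))
          (fun j => (z j).2) (d := d) ?_ hc.2 hτ) hη)
      · rintro ⟨j₂, hj₂, hx1, hx2⟩
        obtain ⟨hr, hcc, hl⟩ := hz j₂ hj₂
        exact hx.2.2 ⟨⟨_, hr⟩, _, hcc, j₂, (Finset.mem_filter.1 hj₂).1, hl, hx1, hx2⟩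
      · intro j hj
        obtain ⟨hr, -⟩ := hz j hj
        exact hc.1 ⟨_, hr⟩
    · refine le_trans (bernProb_mono (T := ∅) h0.le h1 fun x hx => ?_) ?_
      · exact hc ⟨hx.1, hx.2.1⟩
      · simp only [bernProb, bernExp, Set.indicator_empty, mul_zero, Finset.sum_const_zero]
        positivity

end Events

section Assembly

open scoped Classical

variable {n : ℕ}

lemma card_filter_not_of_lt {α : Type*} (s : Finset α) (Φ : α → Prop)
    [DecidablePred Φ] [DecidablePred fun a => ¬ Φ a] {k : ℕ}
    (h : k ≤ 32 * s.card) {l : ℕ} (hl : 32 * (s.filter Φ).card < l) :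
    k < 32 * (s.filter fun a => ¬ Φ a).card + l := by
  have := Finset.card_filter_add_card_filter_not (s := s) Φ
  omega

lemma exists_stableCycle_two {p d : ℝ} {m : ℕ} (ω : GameIdx n → Bool) (L : Finset (Fin n))
    (hL : 15 * n ≤ 32 * L.card) (hLc : 15 * n ≤ 32 * Lᶜ.card) (h0 : 0 < p) (hm : 0 < m)
    (hBrow : 32 * (univ.filter fun i =>
      d < ((univ.filter fun j => ω (false, i, j) = true).card : ℝ)).card < n)
    (hAcol : 32 * (univ.filter fun j =>
      d < ((univ.filter fun i => ω (true, i, j) = true).card : ℝ)).card < n)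
    (hBcol : 32 * (univ.filter fun j =>
      d < ((univ.filter fun i => ω (false, i, j) = true).card : ℝ)).card < n)
    (hedge : ∀ C : Finset (Fin n), n ≤ 4 * C.card → 32 * (univ.filter fun i =>
      ((C.filter fun j => ω (false, i, j) = true).card : ℝ) < p * C.card / 4).card < n)
    (hhit : ∀ R C : Finset (Fin n), 32 * (univ.filter fun i =>
      ω ∈ hitFail d (p * n ^ 2 / 32) m R C i).card < n)
    (hlink : ∀ I R C : Finset (Fin n), C ⊆ L → n ≤ 32 * I.card →
      32 * (Lᶜ.filter fun j => ω ∈ linkFail p d m I R C j).card < n)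
    (hclose : ∀ R C : Finset (Fin n), R ⊆ L →
      32 * (Lᶜ.filter fun i => ω ∈ closeFail d (p * n * m / 16) L R C i).card < n) :
    ∃ r c : ZMod 2 → Fin n,
      IsStableCycle 2 n (fun i j => ω (true, i, j)) (fun i j => ω (false, i, j)) r c := by
  have hn : 0 < n := by omega
  have hn0 : (0 : ℝ) < n := by exact_mod_cast hn
  have hm0 : (0 : ℝ) < m := by exact_mod_cast hm
  set R := L.filter fun i => ¬ d < ((univ.filter fun j => ω (false, i, j) = true).card : ℝ)
  set C := L.filter fun j => ¬ (d < ((univ.filter fun i => ω (true, i, j) = true).card : ℝ) ∨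
    d < ((univ.filter fun i => ω (false, i, j) = true).card : ℝ))
  have hRL : R ⊆ L := Finset.filter_subset _ _
  have hCL : C ⊆ L := Finset.filter_subset _ _
  have hRd : ∀ i ∈ R, ((univ.filter fun j => ω (false, i, j) = true).card : ℝ) ≤ d :=
    fun i hi => not_lt.1 (Finset.mem_filter.1 hi).2
  have hCd : ∀ j ∈ C, ((univ.filter fun i => ω (true, i, j) = true).card : ℝ) ≤ d ∧
      ((univ.filter fun i => ω (false, i, j) = true).card : ℝ) ≤ d := fun j hj => by
    simpa only [not_or, not_lt] using (Finset.mem_filter.1 hj).2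
  have hRcard : 15 * n < 32 * R.card + n := by
    refine card_filter_not_of_lt _ _ hL (lt_of_le_of_lt ?_ hBrow)
    gcongr
    exact Finset.subset_univ _
  have hCcard : 15 * n < 32 * C.card + (n + n) := by
    refine card_filter_not_of_lt _ _ hL
      (lt_of_le_of_lt ?_ (add_lt_add hAcol hBcol))
    rw [Finset.filter_or, ← mul_add]
    gcongr
    refine (Finset.card_union_le _ _).trans ?_
    gcongr <;> exact Finset.subset_univ _
  have hedges : p * n ^ 2 / 32
      ≤ (((R ×ˢ C).filter fun z => ω (false, z.1, z.2) = true).card : ℝ) := by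
    set R' := R.filter fun i =>
      ¬ ((C.filter fun j => ω (false, i, j) = true).card : ℝ) < p * C.card / 4
    have hR' : 14 * n < 32 * R'.card + n := by
      refine card_filter_not_of_lt _ _ (by omega) (lt_of_le_of_lt ?_ (hedge C (by omega)))
      gcongr
      exact Finset.subset_univ _
    have hsum : (((R ×ˢ C).filter fun z => ω (false, z.1, z.2) = true).card : ℝ)
        = ∑ i ∈ R, ((C.filter fun j => ω (false, i, j) = true).card : ℝ) := by
      rw [Finset.card_filter, Finset.sum_product]
      simp only [Finset.card_filter]
      push_cast
      rfl
    have h1 : ∑ i ∈ R', (p * C.card / 4 : ℝ)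
        ≤ ∑ i ∈ R, ((C.filter fun j => ω (false, i, j) = true).card : ℝ) := by
      refine (Finset.sum_le_sum fun i hi => not_lt.1 (Finset.mem_filter.1 hi).2).trans ?_
      exact Finset.sum_le_sum_of_subset_of_nonneg (Finset.filter_subset _ _)
        fun _ _ _ => Nat.cast_nonneg _
    rw [hsum]
    refine le_trans ?_ h1
    rw [Finset.sum_const, nsmul_eq_mul]
    have hc : (13 * n / 32 : ℝ) ≤ C.card := by
      have : 13 * n ≤ 32 * C.card := by omega
      have : (13 * n : ℝ) ≤ 32 * C.card := by exact_mod_cast this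
      linarith
    have hr : (13 * n / 32 : ℝ) ≤ R'.card := by
      have : 13 * n ≤ 32 * R'.card := by omega
      have : (13 * n : ℝ) ≤ 32 * R'.card := by exact_mod_cast this
      linarith
    calc p * n ^ 2 / 32 ≤ (13 * n / 32) * (p * (13 * n / 32) / 4) := by
          nlinarith [mul_pos h0 (pow_pos hn0 2)]
      _ ≤ _ := by gcongr
  set T : Fin n → Finset (Fin n) := fun i₂ =>
    Lᶜ.filter fun j₂ => ∃ i₁ : R, ∃ j₁ ∈ C, IsLink ω i₁ i₂ j₁ j₂
  set I := Lᶜ.filter fun i₂ => m ≤ (R.filter fun i₁ => ∃ j : C, ω (false, i₁, (j : Fin n)) = true ∧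
      ω (true, i₂, (j : Fin n)) = true).card ∧ ((T i₂).card : ℝ) < p * n * m / 16
  have hI : 32 * I.card < n := by
    by_contra! hcon
    set G := Lᶜ.filter fun j => ¬ ω ∈ linkFail p d m I R C j
    have hG : 15 * n < 32 * G.card + n :=
      card_filter_not_of_lt _ _ hLc (hlink I R C hCL hcon)
    have hIpos : (0 : ℝ) < I.card := by
      have : 0 < I.card := by omega
      exact_mod_cast this
    have hlow : ∀ j ∈ G, p * (I.card * m) / 4
        ≤ ((I.filter fun i₂ => ∃ i₁ ∈ R, ∃ j₁ : C, IsLink ω i₁ i₂ j₁ j).card : ℝ) := by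
      intro j hj
      by_contra! hlt
      refine (Finset.mem_filter.1 hj).2 ⟨fun j => (hCd j j.2).1, hRd, fun i₂ hi₂ => ?_, hlt⟩
      exact (Finset.mem_filter.1 hi₂).2.1
    have hdc : ∑ j ∈ G, (I.filter fun i₂ => ∃ i₁ ∈ R, ∃ j₁ : C, IsLink ω i₁ i₂ j₁ j).card
        ≤ ∑ i₂ ∈ I, (T i₂).card := by
      refine (Finset.sum_le_sum_of_subset (Finset.filter_subset _ _)).trans ?_
      simp only [T, Finset.card_filter]
      rw [Finset.sum_comm]
      refine Finset.sum_le_sum fun i _ => Finset.sum_le_sum fun j _ => ?_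
      simp only [Subtype.exists, exists_prop]
      rfl
    have hup : ∑ i₂ ∈ I, ((T i₂).card : ℝ) ≤ I.card * (p * n * m / 16) := by
      rw [← nsmul_eq_mul]
      exact Finset.sum_le_card_nsmul _ _ _ fun i hi => (Finset.mem_filter.1 hi).2.2.le
    have hlo : G.card * (p * (I.card * m) / 4) ≤ ∑ j ∈ G,
        ((I.filter fun i₂ => ∃ i₁ ∈ R, ∃ j₁ : C, IsLink ω i₁ i₂ j₁ j).card : ℝ) := by
      rw [← nsmul_eq_mul]
      exact Finset.card_nsmul_le_sum _ _ _ hlow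
    have hdc' := (Nat.cast_le (α := ℝ)).2 hdc
    push_cast at hdc'
    have hG' : (14 * n / 32 : ℝ) ≤ G.card := by
      have : 14 * n ≤ 32 * G.card := by omega
      have : (14 * n : ℝ) ≤ 32 * G.card := by exact_mod_cast this
      linarith
    have hlt : (14 * n / 32 : ℝ) * (p * (I.card * m) / 4) ≤ I.card * (p * n * m / 16) := by
      refine le_trans ?_ (hlo.trans (hdc'.trans hup))
      gcongr
    nlinarith [mul_pos (mul_pos h0 hn0) (mul_pos hIpos hm0)]
  have hmany : ∀ i, ω ∉ hitFail d (p * n ^ 2 / 32) m R C i →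
      m ≤ (R.filter fun i₁ => ∃ j : C, ω (false, i₁, (j : Fin n)) = true ∧
        ω (true, i, (j : Fin n)) = true).card := by
    intro i hi
    by_contra! hlt
    refine hi ⟨fun i' hi' => le_trans ?_ (hRd i' hi'), fun j hj => le_trans ?_ (hCd j hj).2,
      hedges, ?_⟩
    · gcongr
      exact Finset.subset_univ _
    · gcongr
      exact Finset.subset_univ _
    · simpa only [Subtype.exists, exists_prop, Nat.cast_lt] using hlt
  obtain ⟨i₂, hi₂, hcl, hht, hiI⟩ : ∃ i₂ ∈ Lᶜ, ω ∉ closeFail d (p * n * m / 16) L R C i₂ ∧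
      ω ∉ hitFail d (p * n ^ 2 / 32) m R C i₂ ∧ i₂ ∉ I := by
    by_contra! hcon
    have hcov : Lᶜ ⊆ (Lᶜ.filter fun i => ω ∈ closeFail d (p * n * m / 16) L R C i) ∪
        (univ.filter fun i => ω ∈ hitFail d (p * n ^ 2 / 32) m R C i) ∪ I := by
      intro i hi
      by_cases h1 : ω ∈ closeFail d (p * n * m / 16) L R C i
      · simp only [Finset.mem_union, Finset.mem_filter, hi, h1, and_self, true_or]
      by_cases h2 : ω ∈ hitFail d (p * n ^ 2 / 32) m R C i
      · simp only [Finset.mem_union, Finset.mem_filter, Finset.mem_univ, h2, and_self, or_true,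
          true_or]
      · exact Finset.mem_union_right _ (hcon i hi h1 h2)
    have h1 := Finset.card_le_card hcov
    have h2 := Finset.card_union_le ((Lᶜ.filter fun i =>
      ω ∈ closeFail d (p * n * m / 16) L R C i) ∪
        (univ.filter fun i => ω ∈ hitFail d (p * n ^ 2 / 32) m R C i)) I
    have h3 := Finset.card_union_le (Lᶜ.filter fun i =>
      ω ∈ closeFail d (p * n * m / 16) L R C i)
        (univ.filter fun i => ω ∈ hitFail d (p * n ^ 2 / 32) m R C i)
    have h4 := hclose R C hRL
    have h5 := hhit R C
    omega
  have hT : p * n * m / 16 ≤ ((T i₂).card : ℝ) := by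
    by_contra! hlt
    exact hiI (Finset.mem_filter.2 ⟨hi₂, hmany i₂ hht, hlt⟩)
  have hex : ∃ i₁ : R, ∃ j₁ ∈ C, ∃ j₂ ∈ Lᶜ, IsLink ω i₁ i₂ j₁ j₂ ∧ ω (false, i₂, j₂) = true ∧
      ∀ k, ω (false, (i₁ : Fin n), k) = true → ω (false, i₂, k) = true → k = j₁ ∨ k = j₂ := by
    by_contra hcon
    exact hcl ⟨fun i => hRd i i.2, hT, hcon⟩
  obtain ⟨⟨i₁, hi₁⟩, j₁, hj₁, j₂, hj₂, ⟨hB1, hA1, hA2, hA⟩, hB2, hB⟩ := hex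
  have hi : i₁ ≠ i₂ := fun h => Finset.mem_compl.1 hi₂ (h ▸ hRL hi₁)
  have hj : j₁ ≠ j₂ := fun h => Finset.mem_compl.1 hj₂ (h ▸ hCL hj₁)
  have hinj : ∀ {a b : Fin n}, a ≠ b → Function.Injective (![a, b] : Fin 2 → Fin n) := by
    intro a b h x y
    fin_cases x <;> fin_cases y <;> simp [h, h.symm]
  refine ⟨![i₁, i₂], ![j₁, j₂], ⟨hinj hi, hinj hj, ?_, ?_⟩, ?_, ?_⟩
  · intro k
    fin_cases k
    · exact hB1
    · exact hB2
  · intro k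
    fin_cases k
    · exact hA1
    · exact hA2
  · intro i hir k k' hk hk'
    have hne : ¬ (i = i₁ ∨ i = i₂) := by
      rintro (rfl | rfl)
      · exact hir ⟨0, rfl⟩
      · exact hir ⟨1, rfl⟩
    fin_cases k <;> fin_cases k'
    · rfl
    · exact absurd (hA i hk hk') hne
    · exact absurd (hA i hk' hk) hne
    · rfl
  · intro j hjc k k' hk hk'
    have hne : ¬ (j = j₁ ∨ j = j₂) := by
      rintro (rfl | rfl)
      · exact hjc ⟨0, rfl⟩
      · exact hjc ⟨1, rfl⟩
    fin_cases k <;> fin_cases k'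
    · rfl
    · exact absurd (hB j hk hk') hne
    · exact absurd (hB j hk' hk) hne
    · rfl

end Assembly

section Bound

open scoped Classical

variable {n : ℕ}

lemma bernProb_exists_mem_le {ι α : Type*} [Fintype ι] {p K ε : ℝ} (h0 : 0 ≤ p) (h1 : p ≤ 1)
    (s : Finset α) (E : α → Set (ι → Bool)) (hε : 0 ≤ ε) (hs : (s.card : ℝ) ≤ K)
    (h : ∀ a ∈ s, bernProb p (E a) ≤ ε) :
    bernProb p {ω | ∃ a ∈ s, ω ∈ E a} ≤ K * ε := by
  refine (bernProb_biUnion_le h0 h1 s E fun ω hω => hω).trans ?_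
  refine (Finset.sum_le_card_nsmul _ _ _ h).trans ?_
  rw [nsmul_eq_mul]
  gcongr

lemma bernProb_no_stableCycle_two_le {p d θ : ℝ} {m : ℕ} (hn : 16 ≤ n) (h0 : 0 < p) (h1 : p ≤ 1)
    (hθ : 0 ≤ θ) (hθ1 : θ ≤ 1) (hd : 0 < d) (hm : 0 < m)
    (hdeg : p * n / d ≤ θ ^ 32) (hedge : 16 / (p * n) ≤ θ ^ 32)
    (hmw : (m : ℝ) ≤ p * (p * n ^ 2 / 32) / 4)
    (hhit : 4 * d / (p * (p * n ^ 2 / 32)) + 4 * p * d ≤ θ ^ 32)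
    (hlink : 4 * d ^ 2 / (p * (n / 32 * m)) + 4 * p * (m + d) ≤ θ ^ 32)
    (hclose : 4 / (p * (p * n * m / 16)) + 4 * p * d ≤ θ ^ 32) :
    bernProb p {ω : GameIdx n → Bool | ¬ ∃ r c : ZMod 2 → Fin n,
      IsStableCycle 2 n (fun i j => ω (true, i, j)) (fun i j => ω (false, i, j)) r c}
      ≤ 7 * (16 * θ) ^ n := by
  have hn0 : (0 : ℝ) < n := by
    have : 0 < n := by omega
    exact_mod_cast this
  have hm0 : (0 : ℝ) < m := by exact_mod_cast hm
  have hε : 0 ≤ (2 * θ) ^ n := by positivity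
  have hcard : Fintype.card (Finset (Fin n)) = 2 ^ n := by simp
  obtain ⟨L, -, hLcard⟩ := Finset.exists_subset_card_eq (s := (univ : Finset (Fin n)))
    (n := n / 2) (by simpa using Nat.div_le_self n 2)
  have hLc : Lᶜ.card = n - n / 2 := by rw [Finset.card_compl, hLcard, Fintype.card_fin]
  have hrow : ∀ κ : Fin n ↪ GameIdx n,
      bernProb p {x | d < ((univ.filter fun j => x (κ j) = true).card : ℝ)} ≤ θ ^ 32 :=
    fun κ => (bernProb_card_univ_gt_le h0.le h1 hd κ).trans hdeg
  let Φ : (Fin n → Bool) → Prop := fun x => d < ((univ.filter fun j => x j = true).card : ℝ)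
  have b1 := bernProb_many_row_le h0.le h1 hθ hθ1 false Φ hrow
  have b2 := bernProb_many_col_le h0.le h1 hθ hθ1 true Φ hrow
  have b3 := bernProb_many_col_le h0.le h1 hθ hθ1 false Φ hrow
  have b4 := bernProb_exists_mem_le (K := 2 ^ n) h0.le h1
    (univ.filter fun C : Finset (Fin n) => n ≤ 4 * C.card)
    (fun C => {ω : GameIdx n → Bool | n ≤ 32 * (univ.filter fun i =>
      ((C.filter fun j => ω (false, i, j) = true).card : ℝ) < p * C.card / 4).card}) hε
    (by exact_mod_cast (Finset.card_le_univ _).trans hcard.le)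
    (by
      intro C hC
      refine bernProb_many_row_le h0.le h1 hθ hθ1 false
        (fun x => ((C.filter fun j => x j = true).card : ℝ) < p * C.card / 4) fun κ => ?_
      have hC4 : (n / 4 : ℝ) ≤ C.card := by
        have : (n : ℝ) ≤ 4 * C.card := by exact_mod_cast (Finset.mem_filter.1 hC).2
        linarith
      have hCne : C.Nonempty := by
        rw [← Finset.card_pos]
        exact_mod_cast (by positivity : (0 : ℝ) < n / 4).trans_le hC4
      refine (bernProb_card_lt_le h0 h1 κ C hCne).trans (le_trans ?_ hedge)
      calc 4 / (p * C.card) ≤ 4 / (p * (n / 4)) := by gcongr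
        _ = 16 / (p * n) := by field_simp; norm_num)
  have b5 := bernProb_exists_mem_le (K := 4 ^ n) h0.le h1
    (univ : Finset (Finset (Fin n) × Finset (Fin n)))
    (fun z => {ω : GameIdx n → Bool | n ≤ 32 * (univ.filter fun i =>
      ω ∈ hitFail d (p * n ^ 2 / 32) m z.1 z.2 i).card}) hε
    (by
      rw [Finset.card_univ, Fintype.card_prod, hcard, ← mul_pow]
      norm_num)
    (fun z _ => bernProb_hitFail_le h0 h1 hθ hθ1 hd.le (by positivity) hmw hhit z.1 z.2)
  have b6 := bernProb_exists_mem_le (K := 8 ^ n) h0.le h1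
    (univ.filter fun z : Finset (Fin n) × Finset (Fin n) × Finset (Fin n) =>
      z.2.2 ⊆ L ∧ n ≤ 32 * z.1.card)
    (fun z => {ω : GameIdx n → Bool | n ≤ 32 * (Lᶜ.filter fun j =>
      ω ∈ linkFail p d m z.1 z.2.1 z.2.2 j).card}) hε
    (by
      refine (Nat.cast_le.2 (Finset.card_le_univ _)).trans ?_
      rw [Fintype.card_prod, Fintype.card_prod, hcard, ← mul_pow, ← mul_pow]
      norm_num)
    (fun z hz => bernProb_linkFail_le h0 h1 hθ hθ1 hd.le hm (by omega) hlink L z.1 z.2.1 z.2.2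
      (Finset.mem_filter.1 hz).2.1 (Finset.mem_filter.1 hz).2.2)
  have b7 := bernProb_exists_mem_le (K := 4 ^ n) h0.le h1
    (univ.filter fun z : Finset (Fin n) × Finset (Fin n) => z.1 ⊆ L)
    (fun z => {ω : GameIdx n → Bool | n ≤ 32 * (Lᶜ.filter fun i =>
      ω ∈ closeFail d (p * n * m / 16) L z.1 z.2 i).card}) hε
    (by
      refine (Nat.cast_le.2 (Finset.card_le_univ _)).trans ?_
      rw [Fintype.card_prod, hcard, ← mul_pow]
      norm_num)
    (fun z hz => bernProb_closeFail_le h0 h1 hθ hθ1 (by positivity) hclose L z.1 z.2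
      (Finset.mem_filter.1 hz).2)
  have hK : ∀ K : ℝ, 0 ≤ K → K ≤ 8 → K ^ n * (2 * θ) ^ n ≤ (16 * θ) ^ n := by
    intro K hK0 hK8
    rw [← mul_pow]
    exact pow_le_pow_left₀ (by positivity) (by nlinarith) n
  have b := bernProb_union_le h0.le h1 b1 (bernProb_union_le h0.le h1 b2 (bernProb_union_le h0.le h1
    b3 (bernProb_union_le h0.le h1 b4 (bernProb_union_le h0.le h1 b5
      (bernProb_union_le h0.le h1 b6 b7)))))
  refine (bernProb_mono h0.le h1 fun ω hω => ?_).trans (b.trans ?_)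
  · by_contra hcon
    simp only [Set.mem_union, not_or] at hcon
    obtain ⟨c1, c2, c3, c4, c5, c6, c7⟩ := hcon
    refine hω (exists_stableCycle_two ω L (by omega) (by omega) h0 hm (not_le.1 c1) (not_le.1 c2)
      (not_le.1 c3) ?_ ?_ ?_ ?_)
    · intro C hC
      by_contra! h
      exact c4 ⟨C, by simpa using hC, h⟩
    · intro R C
      by_contra! h
      exact c5 ⟨(R, C), Finset.mem_univ _, h⟩
    · intro I R C hC hI
      by_contra! h
      exact c6 ⟨(I, R, C), by simpa using ⟨hC, hI⟩, h⟩
    · intro R C hR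
      by_contra! h
      exact c7 ⟨(R, C), by simpa using hR, h⟩
  · have k1 := hK 1 (by norm_num) (by norm_num)
    rw [one_pow, one_mul] at k1
    linarith [hK 2 (by norm_num) (by norm_num), hK 4 (by norm_num) (by norm_num),
      hK 8 (by norm_num) le_rfl]

end Bound

section Game

open scoped Classical

variable {n : ℕ}

/-- Configurations of entries are pairs of matrices. -/
def gameEquiv (n : ℕ) :
    (GameIdx n → Bool) ≃ (Fin n → Fin n → Bool) × (Fin n → Fin n → Bool) where
  toFun ω := (fun i j => ω (true, i, j), fun i j => ω (false, i, j))
  invFun z c := if c.1 = true then z.1 c.2.1 c.2.2 else z.2 c.2.1 c.2.2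
  left_inv ω := by
    ext ⟨s, i, j⟩
    cases s <;> simp
  right_inv z := by simp

lemma toReal_pairWeight {p : ℝ} (h0 : 0 ≤ p) (h1 : p ≤ 1) (ω : GameIdx n → Bool) :
    (pairWeight n p (gameEquiv n ω)).toReal = bernWeight p ω := by
  have h : ∀ b, (entryWeight p b).toReal = if b then p else 1 - p := by
    intro b
    cases b
    · simp [entryWeight, h1]
    · simp [entryWeight, h0]
  simp only [pairWeight, gameEquiv, Equiv.coe_fn_mk, bernWeight, ENNReal.toReal_mul,
    ENNReal.toReal_prod, h, Fintype.prod_prod_type, Fintype.prod_bool]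

lemma pairWeight_ne_top (p : ℝ) (z : (Fin n → Fin n → Bool) × (Fin n → Fin n → Bool)) :
    pairWeight n p z ≠ ∞ := by
  have h : ∀ b, entryWeight p b ≠ ∞ := by
    intro b
    cases b <;> simp [entryWeight]
  exact ENNReal.mul_ne_top (ENNReal.prod_ne_top fun _ _ => ENNReal.prod_ne_top fun _ _ => h _)
    (ENNReal.prod_ne_top fun _ _ => ENNReal.prod_ne_top fun _ _ => h _)

lemma toReal_gameMeasure_s17 {p : ℝ} (h0 : 0 ≤ p) (h1 : p ≤ 1)
    (S : Set ((Fin n → Fin n → Bool) × (Fin n → Fin n → Bool))) :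
    (gameMeasure n p S).toReal = bernProb p (gameEquiv n ⁻¹' S) := by
  rw [gameMeasure, Measure.sum_apply _ (MeasurableSet.of_discrete), tsum_fintype,
    ENNReal.toReal_sum]
  · rw [bernProb, bernExp]
    rw [← Equiv.sum_comp (gameEquiv n)]
    refine Finset.sum_congr (by ext; simp) fun ω _ => ?_
    rw [Measure.smul_apply, smul_eq_mul, ENNReal.toReal_mul, toReal_pairWeight h0 h1,
      Measure.dirac_apply' _ MeasurableSet.of_discrete]
    by_cases h : gameEquiv n ω ∈ S <;> simp [h]
  · intro z _
    rw [Measure.smul_apply, smul_eq_mul]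
    exact ENNReal.mul_ne_top (pairWeight_ne_top p z) (measure_ne_top _ _)

end Game

section Asymptotics

/-- The numerical conditions hold once `t = n ^ (1/24)` is large. -/
lemma eventually_parameters {c ε : ℝ} (hc : 0 < c) (hε : 0 < ε) : ∀ᶠ t : ℝ in atTop,
    ∀ p : ℝ, c * (t ^ 16)⁻¹ ≤ p → p ≤ 512 * (t ^ 16)⁻¹ → ∃ (d : ℝ) (m : ℕ),
      0 < p ∧ 0 < d ∧ 0 < m ∧ p * t ^ 24 / d ≤ ε ∧ 16 / (p * t ^ 24) ≤ ε ∧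
      (m : ℝ) ≤ p * (p * (t ^ 24) ^ 2 / 32) / 4 ∧
      4 * d / (p * (p * (t ^ 24) ^ 2 / 32)) + 4 * p * d ≤ ε ∧
      4 * d ^ 2 / (p * (t ^ 24 / 32 * m)) + 4 * p * (m + d) ≤ ε ∧
      4 / (p * (p * t ^ 24 * m / 16)) + 4 * p * d ≤ ε := by
  have hlarge : ∀ K : ℝ, ∀ᶠ t : ℝ in atTop, K / t ≤ ε / 2 := by
    intro K
    have h : Tendsto (fun t : ℝ => K / t) atTop (nhds 0) := tendsto_const_nhds.div_atTop tendsto_id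
    exact (h.eventually_lt_const (half_pos hε)).mono fun _ h => h.le
  have hsq : ∀ K : ℝ, ∀ᶠ t : ℝ in atTop, K ≤ t := fun K => eventually_ge_atTop K
  filter_upwards [hlarge 512, hlarge (16 / c), hlarge (128 / c ^ 2), hlarge 2048, hlarge 6144,
    hlarge (128 / c), hlarge (64 / c ^ 2), hsq 1, hsq (256 / c ^ 2)]
    with t ht1 ht2 ht3 ht4 ht5 ht6 ht7 h1t hct p hp1 hp2
  have ht : 0 < t := by linarith
  have hp0 : 0 < p := lt_of_lt_of_le (by positivity) hp1
  have hle : ∀ K : ℝ, 0 ≤ K → ∀ k : ℕ, k ≠ 0 → K / t ^ k ≤ K / t := by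
    intro K hK k hk
    gcongr
    exact le_self_pow₀ h1t hk
  obtain ⟨m, hm1, hm2⟩ : ∃ m : ℕ, t ^ 12 ≤ m ∧ (m : ℝ) ≤ 2 * t ^ 12 := by
    refine ⟨⌈t ^ 12⌉₊, Nat.le_ceil _, ?_⟩
    have := Nat.ceil_lt_add_one (pow_pos ht 12).le
    have := one_le_pow₀ h1t (n := 12)
    linarith
  have hpd : 4 * p * t ^ 9 ≤ ε / 2 := by
    calc 4 * p * t ^ 9 ≤ 4 * (512 * (t ^ 16)⁻¹) * t ^ 9 := by gcongr
      _ = 2048 / t ^ 7 := by field_simp; norm_num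
      _ ≤ ε / 2 := (hle _ (by norm_num) _ (by norm_num)).trans ht4
  refine ⟨t ^ 9, m, hp0, by positivity, ?_, ?_, ?_, ?_, ?_, ?_, ?_⟩
  · exact_mod_cast (pow_pos ht 12).trans_le hm1
  · calc p * t ^ 24 / t ^ 9 ≤ (512 * (t ^ 16)⁻¹) * t ^ 24 / t ^ 9 := by gcongr
      _ = 512 / t := by field_simp
      _ ≤ ε := by linarith
  · calc 16 / (p * t ^ 24) ≤ 16 / ((c * (t ^ 16)⁻¹) * t ^ 24) := by gcongr
      _ = (16 / c) / t ^ 8 := by field_simp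
      _ ≤ (16 / c) / t := hle _ (by positivity) _ (by norm_num)
      _ ≤ ε := by linarith
  · calc (m : ℝ) ≤ 2 * t ^ 12 := hm2
      _ ≤ c ^ 2 / 128 * t ^ 16 := by
        have : 256 / c ^ 2 ≤ t ^ 4 := hct.trans (le_self_pow₀ h1t (by norm_num))
        rw [div_le_iff₀ (by positivity)] at this
        nlinarith [pow_pos ht 12]
      _ = c * (t ^ 16)⁻¹ * (c * (t ^ 16)⁻¹ * (t ^ 24) ^ 2 / 32) / 4 := by field_simp; norm_num
      _ ≤ _ := by gcongr
  · have : 4 * t ^ 9 / (p * (p * (t ^ 24) ^ 2 / 32)) ≤ ε / 2 :=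
      calc 4 * t ^ 9 / (p * (p * (t ^ 24) ^ 2 / 32))
          ≤ 4 * t ^ 9 / ((c * (t ^ 16)⁻¹) * ((c * (t ^ 16)⁻¹) * (t ^ 24) ^ 2 / 32)) := by gcongr
        _ = (128 / c ^ 2) / t ^ 7 := by field_simp; norm_num
        _ ≤ ε / 2 := (hle _ (by positivity) _ (by norm_num)).trans ht3
    linarith
  · have h1 : 4 * (t ^ 9) ^ 2 / (p * (t ^ 24 / 32 * m)) ≤ ε / 2 :=
      calc 4 * (t ^ 9) ^ 2 / (p * (t ^ 24 / 32 * m))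
          ≤ 4 * (t ^ 9) ^ 2 / ((c * (t ^ 16)⁻¹) * (t ^ 24 / 32 * t ^ 12)) := by gcongr
        _ = (128 / c) / t ^ 2 := by field_simp; norm_num
        _ ≤ ε / 2 := (hle _ (by positivity) _ (by norm_num)).trans ht6
    have h2 : 4 * p * (m + t ^ 9) ≤ ε / 2 :=
      calc 4 * p * (m + t ^ 9) ≤ 4 * (512 * (t ^ 16)⁻¹) * (2 * t ^ 12 + t ^ 12) := by
            gcongr
            norm_num
        _ = 6144 / t ^ 4 := by field_simp; norm_num
        _ ≤ ε / 2 := (hle _ (by norm_num) _ (by norm_num)).trans ht5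
    linarith
  · have : 4 / (p * (p * t ^ 24 * m / 16)) ≤ ε / 2 :=
      calc 4 / (p * (p * t ^ 24 * m / 16))
          ≤ 4 / ((c * (t ^ 16)⁻¹) * ((c * (t ^ 16)⁻¹) * t ^ 24 * t ^ 12 / 16)) := by gcongr
        _ = (64 / c ^ 2) / t ^ 4 := by field_simp; norm_num
        _ ≤ ε / 2 := (hle _ (by positivity) _ (by norm_num)).trans ht7
    linarith

lemma eventually_toReal_gameMeasure_le (p : ℕ → ℝ) (hp : ∀ n, 0 ≤ p n ∧ p n ≤ 1)
    (hrange : ∀ᶠ n : ℕ in atTop,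
      Real.exp (-4 / 3) * (n : ℝ) ^ (-(2 : ℝ) / 3) ≤ p n ∧
        p n ≤ 2 ^ 9 * (n : ℝ) ^ (-(2 : ℝ) / 3)) {θ : ℝ} (hθ : 0 < θ) (hθ1 : θ ≤ 1) :
    ∀ᶠ n : ℕ in atTop, (gameMeasure n (p n)
      {ω | ¬ ∃ r c : ZMod 2 → Fin n, IsStableCycle 2 n ω.1 ω.2 r c}).toReal
        ≤ 7 * (16 * θ) ^ n := by
  have hroot : Tendsto (fun n : ℕ => (n : ℝ) ^ (1 / 24 : ℝ)) atTop atTop :=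
    (tendsto_rpow_atTop (by norm_num)).comp tendsto_natCast_atTop_atTop
  filter_upwards [hrange, eventually_ge_atTop 16,
    hroot.eventually (eventually_parameters (Real.exp_pos (-4 / 3)) (pow_pos hθ 32))]
    with n hn hn16 hpar
  have hn0 : (0 : ℝ) ≤ n := Nat.cast_nonneg n
  have h24 : ((n : ℝ) ^ (1 / 24 : ℝ)) ^ 24 = n := by
    rw [← Real.rpow_natCast, ← Real.rpow_mul hn0]
    norm_num
  have h16 : (((n : ℝ) ^ (1 / 24 : ℝ)) ^ 16)⁻¹ = (n : ℝ) ^ (-(2 : ℝ) / 3) := by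
    rw [← Real.rpow_natCast, ← Real.rpow_mul hn0, ← Real.rpow_neg hn0]
    norm_num
  rw [h24, h16] at hpar
  obtain ⟨d, m, h0, hd, hm, c1, c2, c3, c4, c5, c6⟩ :=
    hpar (p n) hn.1 (hn.2.trans_eq (by norm_num))
  rw [toReal_gameMeasure_s17 h0.le (hp n).2]
  exact bernProb_no_stableCycle_two_le hn16 h0 (hp n).2 hθ.le hθ1 hd hm c1 c2 c3 c4 c5 c6

end Asymptotics

theorem gap_one_failure_prob (p : ℕ → ℝ) (hp : ∀ n, 0 ≤ p n ∧ p n ≤ 1)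
    (hrange : ∀ᶠ n : ℕ in atTop,
      Real.exp (-4 / 3) * (n : ℝ) ^ (-(2 : ℝ) / 3) ≤ p n ∧
        p n ≤ 2 ^ 9 * (n : ℝ) ^ (-(2 : ℝ) / 3)) :
    Tendsto
      (fun n : ℕ => (2.598 : ℝ) ^ n *
        (gameMeasure n (p n)
          {ω | ¬ ∃ r c : ZMod 2 → Fin n, IsStableCycle 2 n ω.1 ω.2 r c}).toReal)
      atTop (nhds 0) := by
  have hgeom : Tendsto (fun n : ℕ => 7 * (2.598 * (16 * (1 / 100)) : ℝ) ^ n) atTop (nhds 0) := by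
    simpa using (tendsto_pow_atTop_nhds_zero_of_lt_one (r := (2.598 * (16 * (1 / 100)) : ℝ))
      (by norm_num) (by norm_num)).const_mul 7
  refine tendsto_of_tendsto_of_tendsto_of_le_of_le' tendsto_const_nhds hgeom
    (Eventually.of_forall fun n => by positivity) ?_
  filter_upwards [eventually_toReal_gameMeasure_le p hp hrange (θ := 1 / 100) (by norm_num)
    (by norm_num)] with n hn
  rw [mul_pow, ← mul_assoc, mul_comm (7 : ℝ), mul_assoc]
  gcongr
end
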